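/- There exist constants c₁ ≥ 2 and c₂ > 0 depending only on d ≥ 3 such that: for all integers L ≥ 1 and K ≥ c₁, every A ⊆ B(0,L), every finite B ⊂ ℤ^d with B ∩ B(0,KL) = A, and every y ∈ A, setting U = B(0,KL), one has 0 ≤ e_A(y) − e_B(y), and moreover (1 − c₂/K)·e_A(y)·q ≤ e_A(y) − e_B(y) ≤ (1 + c₂/K)·e_A(y)·q, where q = P_0[H_{B∖A} ∘ θ_{T_U} < ∞ and H_A ∘ θ_{T_U} = ∞] is the probability that the walk started at 0, after its exit time from U, visits B∖A but never visits A. -/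

import Mathlib

open MeasureTheory ENNReal Set
open scoped Classical NNReal

namespace Disconnection

/-- Points of `ℤ^d`. -/
abbrev Zd (d : ℕ) := Fin d → ℤ

/-- Step distribution of the simple random walk: uniform weight `1/(2d)` on each of the
`2d` unit vectors of `ℤ^d`. -/
noncomputable def stepP (d : ℕ) (v : Zd d) : ℝ≥0∞ :=
  if (∑ i, (v i).natAbs) = 1 then ((2 * d : ℕ) : ℝ≥0∞)⁻¹ else 0

/-- The exponential distribution of rate `1` on `[0,∞)` (as a measure on `ℝ`). -/
noncomputable def expMeasure : Measure ℝ :=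
  MeasureTheory.volume.withDensity fun t => ENNReal.ofReal (if 0 < t then Real.exp (-t) else 0)

/-- Nearest neighbours in `ℤ^d` (Euclidean distance one). -/
def adjacent {d : ℕ} (x y : Zd d) : Prop := (∑ i, (x i - y i).natAbs) = 1

/-- (Outer) boundary `∂A` of a set `A ⊆ ℤ^d`. -/
def bdry {d : ℕ} (A : Set (Zd d)) : Set (Zd d) := {y | y ∉ A ∧ ∃ x ∈ A, adjacent x y}

/-- sup-norm distance between two points of `ℤ^d`. -/
def supDist {d : ℕ} (x y : Zd d) : ℕ := Finset.univ.sup fun i => (x i - y i).natAbs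

/-- closed sup-norm ball `B(x,r)` in `ℤ^d`. -/
def ball {d : ℕ} (x : Zd d) (r : ℕ) : Set (Zd d) := {y | supDist x y ≤ r}

/-- mutual sup-norm distance between two sets. -/
noncomputable def setDist {d : ℕ} (A B : Set (Zd d)) : ℕ := sInf {n | ∃ x ∈ A, ∃ y ∈ B, supDist x y = n}

/-- the box `ℤ^d ∩ [a,b)^d`. -/
def intBox {d : ℕ} (a b : ℤ) : Set (Zd d) := {y | ∀ i, a ≤ y i ∧ y i < b}

/-- A box in `ℤ^d`: a translate of `[0,L)^d ∩ ℤ^d` with `L ≥ 1`. -/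
def isBox {d : ℕ} (S : Set (Zd d)) : Prop :=
  ∃ L : ℕ, 1 ≤ L ∧ ∃ a : Zd d, S = {y | ∀ i, a i ≤ y i ∧ y i < a i + L}

/-- connectedness of a subset of `ℤ^d` by nearest-neighbour paths. -/
def connSet {d : ℕ} (S : Set (Zd d)) : Prop :=
  ∀ a ∈ S, ∀ b ∈ S, ∃ (n : ℕ) (f : ℕ → Zd d), f 0 = a ∧ f n = b ∧
    (∀ k ≤ n, f k ∈ S) ∧ ∀ k < n, adjacent (f k) (f (k + 1))

/-- Euclidean norm of a lattice point. -/
noncomputable def eucNorm {d : ℕ} (x : Zd d) : ℝ := Real.sqrt (∑ i, ((x i : ℝ)) ^ 2)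

/-- A model of the continuous-time simple random walk on `ℤ^d` with unit jump rate:
`Y` is the discrete jump chain and `ζ` are the holding times; under `P x` one has
`Y 0 = x` a.s., and the increments of `Y` together with the holding times are mutually
independent, the increments uniform on the `2d` unit vectors and the holding times
exponential of rate `1`.  This is expressed through the finite-dimensional cylinder
probabilities, which determine the joint law. -/
structure SRW (d : ℕ) (Ω : Type*) [MeasurableSpace Ω] where
  P : Zd d → Measure Ω
  isProb : ∀ x, IsProbabilityMeasure (P x)
  Y : ℕ → Ω → Zd d
  ζ : ℕ → Ω → ℝ
  measurable_Y : ∀ n, Measurable (Y n)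
  measurable_ζ : ∀ n, Measurable (ζ n)
  Y_zero : ∀ x : Zd d, P x {ω | Y 0 ω = x} = 1
  law : ∀ (x : Zd d) (n : ℕ) (s : Fin n → Zd d) (I : Fin n → Set ℝ),
    (∀ i, MeasurableSet (I i)) →
    P x {ω | (∀ i : Fin n, Y ((i : ℕ) + 1) ω - Y (i : ℕ) ω = s i) ∧
             (∀ i : Fin n, ζ (i : ℕ) ω ∈ I i)}
      = (∏ i, stepP d (s i)) * ∏ i, expMeasure (I i)

namespace SRW

variable {d : ℕ} {Ω : Type*} [MeasurableSpace Ω]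

/-- time of the `n`-th jump. -/
noncomputable def S (W : SRW d Ω) (n : ℕ) (ω : Ω) : ℝ := ∑ i ∈ Finset.range n, W.ζ i ω

/-- index of the current step of the jump chain at time `t`. -/
noncomputable def jumpIdx (W : SRW d Ω) (t : ℝ) (ω : Ω) : ℕ := sSup {k : ℕ | W.S k ω ≤ t}

/-- the continuous-time walk `X_t`. -/
noncomputable def X (W : SRW d Ω) (t : ℝ) (ω : Ω) : Zd d := W.Y (W.jumpIdx t ω) ω

/-- entrance time of `A` after time `t` (`∞` if there is none). -/
noncomputable def hitFrom (W : SRW d Ω) (A : Set (Zd d)) (t : ℝ≥0∞) (ω : Ω) : ℝ≥0∞ :=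
  sInf {u : ℝ≥0∞ | ∃ s : ℝ≥0, u = (s : ℝ≥0∞) ∧ t ≤ u ∧ W.X (s : ℝ) ω ∈ A}

/-- entrance time `H_A = inf {t ≥ 0 : X_t ∈ A}`. -/
noncomputable def hit (W : SRW d Ω) (A : Set (Zd d)) (ω : Ω) : ℝ≥0∞ := W.hitFrom A 0 ω

/-- exit time `T_U = inf {t ≥ 0 : X_t ∉ U}`. -/
noncomputable def exit (W : SRW d Ω) (U : Set (Zd d)) (ω : Ω) : ℝ≥0∞ := W.hit Uᶜ ω

/-- hitting time `H̃_A = inf {t ≥ ζ₀ : X_t ∈ A}`. -/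
noncomputable def hitTilde (W : SRW d Ω) (A : Set (Zd d)) (ω : Ω) : ℝ≥0∞ :=
  W.hitFrom A (ENNReal.ofReal (W.ζ 0 ω)) ω

/-- the walk evaluated at a random (possibly infinite) time. -/
noncomputable def Xat (W : SRW d Ω) (τ : Ω → ℝ≥0∞) (ω : Ω) : Zd d := W.X (τ ω).toReal ω

/-- equilibrium measure `e_A(x) = P_x[H̃_A = ∞] 1_A(x)`. -/
noncomputable def eqm (W : SRW d Ω) (A : Set (Zd d)) (x : Zd d) : ℝ :=
  if x ∈ A then (W.P x {ω | W.hitTilde A ω = ⊤}).toReal else 0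

/-- capacity `cap(A) = Σ_x e_A(x)`. -/
noncomputable def cap (W : SRW d Ω) (A : Set (Zd d)) : ℝ := ∑ᶠ x, W.eqm A x

/-- normalized equilibrium measure `ē_A = e_A / cap(A)`. -/
noncomputable def ebar (W : SRW d Ω) (A : Set (Zd d)) (x : Zd d) : ℝ := W.eqm A x / W.cap A

/-- equilibrium measure of `A` relative to `U`: `e_{A,U}(x) = P_x[H̃_A > T_U] 1_A(x)`. -/
noncomputable def eqmRel (W : SRW d Ω) (A U : Set (Zd d)) (x : Zd d) : ℝ :=
  if x ∈ A then (W.P x {ω | W.exit U ω < W.hitTilde A ω}).toReal else 0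

/-- `P_ρ = Σ_x ρ(x) P_x`, the walk started from the initial (sub-)measure with density `ρ`. -/
noncomputable def Pinit (W : SRW d Ω) (ρ : Zd d → ℝ) : Measure Ω :=
  Measure.sum fun x : Zd d => ENNReal.ofReal (ρ x) • W.P x

/-- Green function `g(x,y) = E_x[∫₀^∞ 1{X_s = y} ds]`. -/
noncomputable def green (W : SRW d Ω) (x y : Zd d) : ℝ :=
  ∫ ω, (∫ s in Set.Ioi (0 : ℝ), if W.X s ω = y then (1 : ℝ) else 0) ∂ W.P x

/-- killed Green function `g_U(x,y) = E_x[∫₀^{T_U} 1{X_s = y} ds]`. -/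
noncomputable def greenK (W : SRW d Ω) (U : Set (Zd d)) (x y : Zd d) : ℝ :=
  ∫ ω, (∫ s in Set.Ioi (0 : ℝ),
      if ENNReal.ofReal s < W.exit U ω ∧ W.X s ω = y then (1 : ℝ) else 0) ∂ W.P x

/-- the potential operator `Gf(x) = Σ_y g(x,y) f(y)`. -/
noncomputable def Gop (W : SRW d Ω) (f : Zd d → ℝ) (x : Zd d) : ℝ :=
  ∑ᶠ y, W.green x y * f y

/-- successive return times to `A` (between excursions out of `U`): `Rt A U 0 = R₁ = H_A`. -/
noncomputable def Rt (W : SRW d Ω) (A U : Set (Zd d)) : ℕ → Ω → ℝ≥0∞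
  | 0 => W.hit A
  | k + 1 => fun ω => W.hitFrom A (W.hitFrom Uᶜ (W.Rt A U k ω) ω) ω

/-- successive departure times from `U`: `Dt A U k = D_{k+1}`. -/
noncomputable def Dt (W : SRW d Ω) (A U : Set (Zd d)) (k : ℕ) (ω : Ω) : ℝ≥0∞ :=
  W.hitFrom Uᶜ (W.Rt A U k ω) ω

/-- number of excursions from `A` to the complement of `U`:
`N_{A,U} = sup {k ≥ 1 : D_k < ∞}` (with `sup ∅ = 0`). -/
noncomputable def Nexc (W : SRW d Ω) (A U : Set (Zd d)) (ω : Ω) : ℕ :=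
  sSup {n | 0 < n ∧ W.Dt A U (n - 1) ω < ⊤}

end SRW

end Disconnection

open Disconnection

namespace S5

/-- signed unit vectors -/
def e {d : ℕ} (j : Fin d × Bool) : Zd d := if j.2 then Pi.single j.1 1 else -Pi.single j.1 1

/-- opposite direction -/
def op {d : ℕ} (j : Fin d × Bool) : Fin d × Bool := (j.1, !j.2)

lemma e_op {d : ℕ} (j : Fin d × Bool) : e (op j) = - e j := by
  rcases j with ⟨i, b⟩; cases b <;> simp [e, op]

/-- sum over neighbours -/
noncomputable def sm {d : ℕ} (u : Zd d → ℝ) (x : Zd d) : ℝ := ∑ j, u (x + e j)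

/-- squared Euclidean norm -/
noncomputable def nsq {d : ℕ} (x : Zd d) : ℝ := ∑ i, ((x i : ℝ)) ^ 2

lemma mem_ball {d : ℕ} (x : Zd d) (r : ℕ) : x ∈ ball (0 : Zd d) r ↔ ∀ i, |x i| ≤ (r : ℤ) := by
  simp only [ball, supDist, Set.mem_ofPred_eq, Finset.sup_le_iff, Finset.mem_univ, true_imp_iff]
  refine forall_congr' fun i => ?_
  simp only [Pi.zero_apply, zero_sub, Int.natAbs_neg]
  rw [abs_le]
  omega

lemma e_apply {d : ℕ} (j : Fin d × Bool) (i : Fin d) :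
    e j i = if i = j.1 then (if j.2 then 1 else -1) else 0 := by
  rcases j with ⟨k, b⟩
  by_cases h : i = k
  · subst h; cases b <;> simp [e]
  · cases b <;> simp [e, h]

/-- sign of direction -/
def sg {d : ℕ} (j : Fin d × Bool) : ℝ := if j.2 then 1 else -1

lemma nsq_add {d : ℕ} (x : Zd d) (j : Fin d × Bool) :
    nsq (x + e j) = nsq x + 2 * sg j * (x j.1 : ℝ) + 1 := by
  have : ∀ i, (((x + e j) i : ℤ) : ℝ) ^ 2 = (x i : ℝ) ^ 2 +
      (if i = j.1 then 2 * sg j * (x i : ℝ) + 1 else 0) := by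
    intro i
    simp only [Pi.add_apply, e_apply, sg]
    by_cases h : i = j.1
    · rcases j with ⟨k, b⟩; cases b <;> simp [h] <;> ring
    · simp [h]
  unfold nsq
  rw [Finset.sum_congr rfl (fun i _ => this i), Finset.sum_add_distrib]
  simp; ring

lemma ball_add {d : ℕ} {x : Zd d} {r : ℕ} (hx : x ∈ ball (0 : Zd d) r) (j : Fin d × Bool) :
    x + e j ∈ ball (0 : Zd d) (r + 1) := by
  rw [mem_ball] at *
  intro i
  have := hx i
  simp only [Pi.add_apply, e_apply]
  rw [abs_le] at *
  push_cast
  split_ifs <;> omega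

lemma ball_finite {d : ℕ} (r : ℕ) : (ball (0 : Zd d) r).Finite := by
  have : ball (0 : Zd d) r ⊆ Set.Icc (fun _ => -(r : ℤ)) (fun _ => (r : ℤ)) := by
    intro x hx
    rw [mem_ball] at hx
    exact ⟨fun i => (abs_le.1 (hx i)).1, fun i => (abs_le.1 (hx i)).2⟩
  exact (Set.finite_Icc _ _).subset this

lemma nsq_nonneg {d : ℕ} (x : Zd d) : 0 ≤ nsq x := Finset.sum_nonneg fun i _ => sq_nonneg _

lemma coord_le {d : ℕ} (x : Zd d) (i : Fin d) : (x i : ℝ) ^ 2 ≤ nsq x :=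
  Finset.single_le_sum (f := fun i => (x i : ℝ) ^ 2) (fun i _ => sq_nonneg _) (Finset.mem_univ i)

lemma nsq_le_of_ball {d : ℕ} {x : Zd d} {r : ℕ} (hx : x ∈ ball (0 : Zd d) r) :
    nsq x ≤ d * (r : ℝ) ^ 2 := by
  rw [mem_ball] at hx
  have : ∀ i ∈ (Finset.univ : Finset (Fin d)), (x i : ℝ) ^ 2 ≤ (r : ℝ) ^ 2 := by
    intro i _
    have h := hx i
    have h2 : |(x i : ℝ)| ≤ (r : ℝ) := by exact_mod_cast h
    exact sq_le_sq' (abs_le.1 h2).1 (abs_le.1 h2).2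
  simpa [nsq] using Finset.sum_le_sum this

lemma nsq_ge_of_not_ball {d : ℕ} {x : Zd d} {r : ℕ} (hx : x ∉ ball (0 : Zd d) r) :
    (r : ℝ) ^ 2 ≤ nsq x := by
  rw [mem_ball] at hx
  push Not at hx
  obtain ⟨i, hi⟩ := hx
  have h2 : (r : ℝ) < |(x i : ℝ)| := by exact_mod_cast hi
  refine le_trans ?_ (coord_le x i)
  rw [← sq_abs (x i : ℝ)]
  exact pow_le_pow_left₀ (by positivity) h2.le 2

lemma mem_ball_of_nsq {d : ℕ} {x : Zd d} {r : ℕ} (hx : nsq x < ((r : ℝ) + 1) ^ 2) :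
    x ∈ ball (0 : Zd d) r := by
  rw [mem_ball]
  intro i
  by_contra hc
  push Not at hc
  have h2 : ((r + 1 : ℤ) : ℝ) ≤ |(x i : ℝ)| := by exact_mod_cast hc
  push_cast at h2
  have := coord_le x i
  rw [← sq_abs (x i : ℝ)] at this
  have := pow_le_pow_left₀ (by positivity) h2 2
  linarith

/-- maximum principle -/
lemma max_principle {d : ℕ} (hd : 0 < d) (T : Set (Zd d)) (hT : T.Finite) (u : Zd d → ℝ)
    (hsub : ∀ x ∈ T, 2 * (d : ℝ) * u x ≤ sm u x)
    (hb : ∀ x ∈ T, ∀ j, x + e j ∉ T → u (x + e j) ≤ 0) : ∀ x ∈ T, u x ≤ 0 := by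
  by_contra hcon
  push Not at hcon
  obtain ⟨x₀, hx₀, hpos⟩ := hcon
  have hne : hT.toFinset.Nonempty := ⟨x₀, by simpa using hx₀⟩
  obtain ⟨m, hm, hmax⟩ := Finset.exists_max_image hT.toFinset u hne
  simp only [Set.Finite.mem_toFinset] at hm hmax
  have hmp : 0 < u m := hpos.trans_le (hmax _ hx₀)
  -- maximizers
  set i0 : Fin d := ⟨0, hd⟩
  have hne2 : (hT.toFinset.filter (fun x => u x = u m)).Nonempty := ⟨m, by simp [hm]⟩
  obtain ⟨z, hz, hzmax⟩ := Finset.exists_max_image _ (fun x : Zd d => x i0) hne2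
  simp only [Finset.mem_filter, Set.Finite.mem_toFinset] at hz hzmax
  have hle : ∀ j, u (z + e j) ≤ u z := by
    intro j
    by_cases h : z + e j ∈ T
    · rw [hz.2]; exact hmax _ h
    · have := hb z hz.1 j h
      rw [hz.2]; linarith
  have hlt : u (z + e (i0, true)) < u z := by
    by_cases h : z + e (i0, true) ∈ T
    · refine lt_of_le_of_ne (hle _) fun heq => ?_
      have := hzmax (z + e (i0, true)) ⟨h, heq.trans hz.2⟩
      simp [e_apply] at this
    · have := hb z hz.1 _ h
      rw [hz.2]; linarith
  have h1 : sm u z < ∑ j : Fin d × Bool, u z :=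
    Finset.sum_lt_sum (fun j _ => hle j) ⟨_, Finset.mem_univ _, hlt⟩
  have h2 := hsub z hz.1
  simp at h1
  linarith

end S5

namespace S5

/-- ratio -/
noncomputable def F {d : ℕ} (h : Zd d → ℝ) (i : Fin d × Bool) (x : Zd d) : ℝ := h (x + e i) / h x

/-- squared relative gradient -/
noncomputable def Q {d : ℕ} (h : Zd d → ℝ) (x : Zd d) : ℝ := ∑ i, (F h i x - 1) ^ 2

lemma F_pos {d : ℕ} {h : Zd d → ℝ} (hp : ∀ x, 0 < h x) (i : Fin d × Bool) (x : Zd d) :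
    0 < F h i x := div_pos (hp _) (hp _)

lemma sum_F {d : ℕ} {h : Zd d → ℝ} (hp : ∀ x, 0 < h x) {x : Zd d} (hx : sm h x = 2 * d * h x) :
    ∑ i, F h i x = 2 * d := by
  have := (hp x).ne'
  unfold F
  rw [← Finset.sum_div]
  unfold sm at hx
  rw [hx]; field_simp

lemma F_le {d : ℕ} {h : Zd d → ℝ} (hp : ∀ x, 0 < h x) {x : Zd d} (hx : sm h x = 2 * d * h x)
    (i : Fin d × Bool) : F h i x ≤ 2 * d := by
  rw [← sum_F hp hx]
  exact Finset.single_le_sum (f := fun i => F h i x) (fun i _ => (F_pos hp i x).le)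
    (Finset.mem_univ i)

lemma Q_nonneg {d : ℕ} (h : Zd d → ℝ) (x : Zd d) : 0 ≤ Q h x :=
  Finset.sum_nonneg fun i _ => sq_nonneg _

lemma Q_le {d : ℕ} {h : Zd d → ℝ} (hp : ∀ x, 0 < h x) {x : Zd d} (hx : sm h x = 2 * d * h x) :
    Q h x ≤ 4 * (d : ℝ) ^ 2 := by
  have hs := sum_F hp hx
  have h1 : Q h x = ∑ i, (F h i x) ^ 2 - 2 * d := by
    have : ∀ i ∈ (Finset.univ : Finset (Fin d × Bool)),
        (F h i x - 1) ^ 2 = (F h i x) ^ 2 - 2 * F h i x + 1 := fun i _ => by ring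
    unfold Q
    rw [Finset.sum_congr rfl this, Finset.sum_add_distrib, Finset.sum_sub_distrib,
      ← Finset.mul_sum, hs]
    simp; ring
  have h2 : ∑ i, (F h i x) ^ 2 ≤ ∑ i, (2 * d) * F h i x := by
    refine Finset.sum_le_sum fun i _ => ?_
    have := F_le hp hx i
    have := F_pos hp i x
    nlinarith
  rw [← Finset.mul_sum, hs] at h2
  have : (0:ℝ) ≤ d := by positivity
  rw [h1]; nlinarith

lemma F_back {d : ℕ} {h : Zd d → ℝ} (i : Fin d × Bool) (x : Zd d) :
    F h i (x + e (op i)) = 1 / F h (op i) x := by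
  unfold F
  rw [e_op]; simp

lemma LQ {d : ℕ} {h : Zd d → ℝ} (hp : ∀ x, 0 < h x) {x : Zd d} (hx : sm h x = 2 * d * h x)
    (hxj : ∀ j, sm h (x + e j) = 2 * d * h (x + e j)) :
    ∑ i, F h (op i) x * (1 / F h (op i) x - F h i x) ^ 2 ≤
      ∑ j, F h j x * (Q h (x + e j) - Q h x) := by
  have h1 : ∀ j, Q h (x + e j) - Q h x = ∑ i, ((F h i (x + e j) - F h i x) ^ 2 +
      2 * (F h i x - 1) * (F h i (x + e j) - F h i x)) := by
    intro j
    unfold Q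
    rw [← Finset.sum_sub_distrib]
    exact Finset.sum_congr rfl fun i _ => by ring
  have h2 : ∀ i, ∑ j, F h j x * (F h i (x + e j) - F h i x) = 0 := by
    intro i
    have : ∀ j ∈ (Finset.univ : Finset (Fin d × Bool)), F h j x * (F h i (x + e j) - F h i x)
        = h (x + e i + e j) / h x - F h i x * F h j x := by
      intro j _
      have a1 := (hp x).ne'
      have a2 := (hp (x + e j)).ne'
      have a3 : x + e j + e i = x + e i + e j := by abel
      unfold F
      rw [a3]
      field_simp
    rw [Finset.sum_congr rfl this, Finset.sum_sub_distrib, ← Finset.mul_sum, sum_F hp hx,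
      ← Finset.sum_div]
    have := hxj i
    unfold sm at this
    rw [this]; unfold F
    have a1 := (hp x).ne'
    field_simp; ring
  have h3 : ∑ j, F h j x * (Q h (x + e j) - Q h x) =
      ∑ i, ∑ j, F h j x * (F h i (x + e j) - F h i x) ^ 2 := by
    have : ∀ i ∈ (Finset.univ : Finset (Fin d × Bool)),
      ∑ j, F h j x * (F h i (x + e j) - F h i x) ^ 2 =
        ∑ j, F h j x * ((F h i (x + e j) - F h i x) ^ 2 +
      2 * (F h i x - 1) * (F h i (x + e j) - F h i x)) := by
      intro i _
      have : ∀ j ∈ (Finset.univ : Finset (Fin d × Bool)), F h j x * ((F h i (x + e j) - F h i x) ^ 2 +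
        2 * (F h i x - 1) * (F h i (x + e j) - F h i x)) =
        F h j x * (F h i (x + e j) - F h i x) ^ 2 +
         2 * (F h i x - 1) * (F h j x * (F h i (x + e j) - F h i x)) := fun j _ => by ring
      rw [Finset.sum_congr rfl this, Finset.sum_add_distrib, ← Finset.mul_sum, h2]
      ring
    rw [Finset.sum_congr rfl this, Finset.sum_comm]
    refine Finset.sum_congr rfl fun j _ => ?_
    rw [h1, Finset.mul_sum]
  rw [h3]
  refine Finset.sum_le_sum fun i _ => ?_
  rw [← F_back]
  exact Finset.single_le_sum (f := fun j => F h j x * (F h i (x + e j) - F h i x) ^ 2)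
    (fun j _ => mul_nonneg (F_pos hp j x).le (sq_nonneg _)) (Finset.mem_univ (op i))

/-- algebraic lemma -/
lemma alg {d : ℕ} (hd : 1 ≤ d) (a b : Fin d → ℝ) (ha : ∀ i, 0 < a i) (hb : ∀ i, 0 < b i)
    (hs : ∑ i, (a i + b i) = 2 * d) :
    ∑ i, ((a i - 1) ^ 2 + (b i - 1) ^ 2) ≤
      6 * (d : ℝ) ^ 3 * √(∑ i, (1 - a i * b i) ^ 2) := by
  set δ := √(∑ i, (1 - a i * b i) ^ 2) with hδ
  have hd' : (1 : ℝ) ≤ d := by exact_mod_cast hd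
  have hδ0 : 0 ≤ δ := Real.sqrt_nonneg _
  have hp : ∀ i, |1 - a i * b i| ≤ δ := by
    intro i
    refine Real.abs_le_sqrt ?_
    exact Finset.single_le_sum (f := fun i => (1 - a i * b i) ^ 2) (fun i _ => sq_nonneg _)
      (Finset.mem_univ i)
  have hlow : ∀ i, -(2 * δ) ≤ a i + b i - 2 := by
    intro i
    by_contra hc
    push Not at hc
    have h1 := (abs_le.1 (hp i)).2
    have := ha i
    have := hb i
    nlinarith [sq_nonneg (a i - b i)]
  have hsum0 : ∑ i, (a i + b i - 2) = 0 := by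
    rw [Finset.sum_sub_distrib, hs]; simp; ring
  have hup : ∀ i, a i + b i - 2 ≤ 2 * d * δ := by
    intro i
    have h1 : a i + b i - 2 + 2 * δ ≤ ∑ i, (a i + b i - 2 + 2 * δ) :=
      Finset.single_le_sum (f := fun i => a i + b i - 2 + 2 * δ)
        (fun i _ => by have := hlow i; linarith) (Finset.mem_univ i)
    rw [Finset.sum_add_distrib, hsum0] at h1
    simp at h1
    linarith
  have hab : ∀ i, a i + b i ≤ 2 * d := by
    intro i
    rw [← hs]
    exact Finset.single_le_sum (f := fun i => a i + b i)
        (fun i _ => by have := ha i; have := hb i; linarith) (Finset.mem_univ i)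
  have hterm : ∀ i, (a i - 1) ^ 2 + (b i - 1) ^ 2 ≤ 2 * (a i + b i - 2) + (4 * d ^ 2 * δ + 2 * δ) := by
    intro i
    have h0 : (a i - 1) ^ 2 + (b i - 1) ^ 2 = 2 * (a i + b i - 2) + (a i + b i - 2) ^ 2
      + 2 * (1 - a i * b i) := by ring
    have h1 := (abs_le.1 (hp i)).2
    have h2 := hup i
    have h3 := hlow i
    have h4 := hab i
    have h5 := ha i
    have h6 := hb i
    have h7 : |a i + b i - 2| ≤ 2 * d * δ := abs_le.2 ⟨by nlinarith, h2⟩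
    have h8 : |a i + b i - 2| ≤ 2 * d := abs_le.2 ⟨by linarith, by linarith⟩
    have h9 : (a i + b i - 2) ^ 2 ≤ 2 * d * (2 * d * δ) := by
      rw [← sq_abs, sq]
      exact mul_le_mul h8 h7 (abs_nonneg _) (by positivity)
    nlinarith
  have hfin := Finset.sum_le_sum (s := Finset.univ) fun i _ => hterm i
  rw [Finset.sum_add_distrib (f := fun i => 2 * (a i + b i - 2)), ← Finset.mul_sum, hsum0] at hfin
  simp only [mul_zero, Finset.sum_const, Finset.card_univ, Fintype.card_fin, nsmul_eq_mul, zero_add] at hfin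
  refine hfin.trans ?_
  have e1 : (d : ℝ) ≤ d ^ 3 := by nlinarith [mul_nonneg (sub_nonneg.2 hd') (sub_nonneg.2 hd'), sq_nonneg (d:ℝ)]
  nlinarith [mul_le_mul_of_nonneg_right e1 hδ0]

lemma LQ2 {d : ℕ} (hd : 1 ≤ d) {h : Zd d → ℝ} (hp : ∀ x, 0 < h x) {x : Zd d}
    (hx : sm h x = 2 * d * h x)
    (hxj : ∀ j, sm h (x + e j) = 2 * d * h (x + e j)) :
    (1 / (36 * (d : ℝ) ^ 7)) * Q h x ^ 2 ≤ ∑ j, F h j x * (Q h (x + e j) - Q h x) := by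
  refine le_trans ?_ (LQ hp hx hxj)
  have hd' : (1 : ℝ) ≤ d := by exact_mod_cast hd
  have hterm : ∀ i, 1 / (2 * (d : ℝ)) * (1 - F h i x * F h (op i) x) ^ 2 ≤
      F h (op i) x * (1 / F h (op i) x - F h i x) ^ 2 := by
    intro i
    have h1 := F_pos hp (op i) x
    have h2 := F_le hp hx (op i)
    have : F h (op i) x * (1 / F h (op i) x - F h i x) ^ 2 =
      1 / F h (op i) x * (1 - F h i x * F h (op i) x) ^ 2 := by field_simp
    rw [this]
    gcongr
  refine le_trans ?_ (Finset.sum_le_sum fun i _ => hterm i)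
  have h1 := alg hd (fun i => F h (i, true) x) (fun i => F h (i, false) x)
    (fun i => F_pos hp _ x) (fun i => F_pos hp _ x)
    (by have := sum_F hp hx; simpa [Fintype.sum_prod_type] using this)
  have h2 : Q h x = ∑ i, ((F h (i, true) x - 1) ^ 2 + (F h (i, false) x - 1) ^ 2) := by
    simp [Q, Fintype.sum_prod_type]
  rw [← h2] at h1
  have h3 : Q h x ^ 2 ≤ 36 * (d : ℝ) ^ 6 * ∑ i, (1 - F h (i, true) x * F h (i, false) x) ^ 2 := by
    have := pow_le_pow_left₀ (Q_nonneg h x) h1 2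
    rw [mul_pow, Real.sq_sqrt (Finset.sum_nonneg fun i _ => sq_nonneg _)] at this
    refine this.trans (le_of_eq ?_)
    ring
  have h4 : ∑ i, 1 / (2 * (d : ℝ)) * (1 - F h i x * F h (op i) x) ^ 2 =
      1 / (d : ℝ) * ∑ i, (1 - F h (i, true) x * F h (i, false) x) ^ 2 := by
    rw [← Finset.mul_sum, Fintype.sum_prod_type]
    simp only [Fintype.sum_bool, op, Bool.not_true, Bool.not_false]
    rw [Finset.mul_sum, Finset.mul_sum]
    refine Finset.sum_congr rfl fun i _ => ?_
    field_simp; ring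
  rw [h4]
  calc _ ≤ (1 / (36 * (d : ℝ) ^ 7)) * (36 * (d : ℝ) ^ 6 * ∑ i, (1 - F h (i, true) x * F h (i, false) x) ^ 2) := by
        gcongr
    _ = _ := by field_simp

end S5

namespace S5

lemma theta_ineq {θ : ℝ} (h : θ ≤ 1 / 2) : 1 ≤ (1 + 2 * θ + 8 * θ ^ 2) * (1 - θ) ^ 2 := by
  have : (1 + 2 * θ + 8 * θ ^ 2) * (1 - θ) ^ 2 - 1 = θ ^ 2 * (4 * (1 / 2 - θ) * (5 / 2 - 2 * θ)) := by ring
  have h2 : 0 ≤ θ ^ 2 * (4 * (1 / 2 - θ) * (5 / 2 - 2 * θ)) := by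
    have : 0 ≤ 1 / 2 - θ := by linarith
    have : 0 ≤ 5 / 2 - 2 * θ := by linarith
    positivity
  linarith

lemma sum_sg {d : ℕ} (x : Zd d) : ∑ j : Fin d × Bool, (2 * sg j * (x j.1 : ℝ) + 1) = 2 * d := by
  simp [Fintype.sum_prod_type, sg, Finset.sum_add_distrib]
  ring

/-- bound at the maximum point, main case -/
lemma max_point {d : ℕ} (hd : 1 ≤ d) {h : Zd d → ℝ} (hp : ∀ x, 0 < h x) {x : Zd d}
    (hx : sm h x = 2 * d * h x)
    (hxj : ∀ j, sm h (x + e j) = 2 * d * h (x + e j)) {R : ℝ} (hR : 1 ≤ R)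
    (hxR : nsq x ≤ R ^ 2)
    (hρ : 6 * R ≤ R ^ 2 - nsq x)
    (hmax : ∀ j, Q h (x + e j) * (R ^ 2 - nsq (x + e j)) ^ 2 ≤ Q h x * (R ^ 2 - nsq x) ^ 2) :
    √(Q h x) * (R ^ 2 - nsq x) ≤ 5760 * (d : ℝ) ^ 8 * R := by
  have hd' : (1 : ℝ) ≤ d := by exact_mod_cast hd
  set ρ := R ^ 2 - nsq x with hρd
  have hρ0 : 0 < ρ := by linarith
  have hρR : ρ ≤ R ^ 2 := by have := nsq_nonneg x; linarith
  set q := Q h x with hq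
  have hq0 : 0 ≤ q := Q_nonneg h x
  rcases hq0.eq_or_lt with h0 | hqpos
  · rw [← h0]; simp; positivity
  set θ : Fin d × Bool → ℝ := fun j => (2 * sg j * (x j.1 : ℝ) + 1) / ρ with hθ
  have hxc : ∀ i, |(x i : ℝ)| ≤ R := fun i => abs_le_of_sq_le_sq ((coord_le x i).trans hxR) (by linarith)
  have hθb : ∀ j, |θ j| ≤ 3 * R / ρ := by
    intro j
    simp only [hθ]
    rw [abs_div, abs_of_pos hρ0]
    gcongr
    have h1 := abs_le.1 (hxc j.1)
    unfold sg
    rw [abs_le]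
    split_ifs <;> constructor <;> linarith [h1.1, h1.2]
  have hθh : ∀ j, |θ j| ≤ 1 / 2 := by
    intro j
    refine (hθb j).trans ?_
    rw [div_le_iff₀ hρ0]; linarith
  have hρj : ∀ j, R ^ 2 - nsq (x + e j) = ρ * (1 - θ j) := by
    intro j
    rw [nsq_add]
    simp only [hθ]
    rw [mul_sub, mul_one, mul_div_cancel₀ _ hρ0.ne', hρd]
    ring
  have hstep : ∀ j, Q h (x + e j) - q ≤ q * (2 * θ j + 8 * θ j ^ 2) := by
    intro j
    have h1 := hmax j
    rw [hρj] at h1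
    have h2 := theta_ineq (abs_le.1 (hθh j)).2
    have h3 : 0 < (1 - θ j) ^ 2 := by
      have := (abs_le.1 (hθh j)).2
      have : 0 < 1 - θ j := by linarith
      positivity
    have h4 : Q h (x + e j) * (1 - θ j) ^ 2 ≤ q := by
      have h5 : (Q h (x + e j) * (1 - θ j) ^ 2) * ρ ^ 2 ≤ q * ρ ^ 2 := by
        calc _ = Q h (x + e j) * (ρ * (1 - θ j)) ^ 2 := by ring
          _ ≤ _ := h1
      exact le_of_mul_le_mul_right h5 (by positivity)
    have h6 : Q h (x + e j) * (1 - θ j) ^ 2 ≤ (q * (1 + 2 * θ j + 8 * θ j ^ 2)) * (1 - θ j) ^ 2 := by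
      nlinarith
    have := le_of_mul_le_mul_right h6 h3
    linarith
  have hF1 : ∀ j, |F h j x - 1| ≤ √q := by
    intro j
    refine Real.abs_le_sqrt ?_
    exact Finset.single_le_sum (f := fun i => (F h i x - 1) ^ 2) (fun i _ => sq_nonneg _)
      (Finset.mem_univ j)
  have hmain := LQ2 hd hp hx hxj
  rw [← hq] at hmain
  have hterm : ∀ j, F h j x * (Q h (x + e j) - q) ≤
      q * (2 * θ j + 2 * (√q * (3 * R / ρ)) + 8 * (3 * R / ρ) ^ 2 * F h j x) := by
    intro j
    have hFp := F_pos hp j x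
    calc _ ≤ F h j x * (q * (2 * θ j + 8 * θ j ^ 2)) := by
          gcongr; exact hstep j
      _ = q * (2 * θ j + 2 * ((F h j x - 1) * θ j) + 8 * θ j ^ 2 * F h j x) := by ring
      _ ≤ _ := by
        have h1 : (F h j x - 1) * θ j ≤ √q * (3 * R / ρ) := by
          refine (le_abs_self _).trans ?_
          rw [abs_mul]
          exact mul_le_mul (hF1 j) (hθb j) (abs_nonneg _) (Real.sqrt_nonneg _)
        have h2 : θ j ^ 2 ≤ (3 * R / ρ) ^ 2 := by
          rw [← sq_abs (θ j)]
          exact pow_le_pow_left₀ (abs_nonneg _) (hθb j) 2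
        gcongr
  have hs3 : ∑ j, 8 * (3 * R / ρ) ^ 2 * F h j x = 8 * (3 * R / ρ) ^ 2 * (2 * d) := by
    rw [← Finset.mul_sum, sum_F hp hx]
  have h1 := hmain.trans (Finset.sum_le_sum fun j _ => hterm j)
  rw [← Finset.mul_sum, Finset.sum_add_distrib, Finset.sum_add_distrib, ← Finset.mul_sum,
    ← Finset.mul_sum, hs3] at h1
  have hsθ : ∑ j, θ j = 2 * d / ρ := by
    simp only [hθ]
    rw [← Finset.sum_div, sum_sg]
  rw [hsθ] at h1
  simp only [Finset.sum_const, Finset.card_univ, Fintype.card_prod, Fintype.card_fin,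
    Fintype.card_bool, nsmul_eq_mul] at h1
  push_cast at h1
  set s := √q * ρ with hs
  have hs0 : 0 ≤ s := by positivity
  have hqq : √q ^ 2 = q := Real.sq_sqrt hq0
  have h2 : (1 / (36 * (d : ℝ) ^ 7)) * s ^ 2 ≤ 4 * d * ρ + 12 * d * R * s + 144 * d * R ^ 2 := by
    have h3 : q * ((1 / (36 * (d : ℝ) ^ 7)) * q) ≤ q * (2 * (2 * ↑d / ρ) + 2 * (↑d * 2 * (√q * (3 * R / ρ))) + 8 * (3 * R / ρ) ^ 2 * (2 * ↑d)) := by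
      refine le_trans (le_of_eq ?_) h1
      ring
    have h4 := le_of_mul_le_mul_left h3 hqpos
    have h5 := mul_le_mul_of_nonneg_right h4 (sq_nonneg ρ)
    calc _ = (1 / (36 * (d : ℝ) ^ 7)) * q * ρ ^ 2 := by rw [hs, mul_pow, hqq]; ring
      _ ≤ _ := h5
      _ = _ := by rw [hs]; field_simp; ring
  have h3 : s ^ 2 ≤ 36 * (d : ℝ) ^ 7 * (12 * d * R * s + 148 * d * R ^ 2) := by
    have : s ^ 2 = 36 * (d : ℝ) ^ 7 * ((1 / (36 * (d : ℝ) ^ 7)) * s ^ 2) := by field_simp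
    rw [this]
    have : 4 * d * ρ ≤ 4 * d * R ^ 2 := by gcongr
    gcongr
    linarith
  by_contra hc
  push Not at hc
  have hd8 : (1 : ℝ) ≤ (d : ℝ) ^ 8 := one_le_pow₀ hd'
  have hsR : R ≤ s := by nlinarith
  have h4 : 36 * (d : ℝ) ^ 7 * (12 * d * R * s + 148 * d * R ^ 2) ≤ 5760 * (d : ℝ) ^ 8 * R * s := by
    have : R ^ 2 ≤ R * s := by nlinarith
    calc _ = 36 * (d : ℝ) ^ 8 * (12 * (R * s) + 148 * R ^ 2) := by ring
      _ ≤ 36 * (d : ℝ) ^ 8 * (12 * (R * s) + 148 * (R * s)) := by gcongr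
      _ = _ := by ring
  have : 0 < s := by linarith
  nlinarith

lemma grad {d : ℕ} (hd : 1 ≤ d) {h : Zd d → ℝ} (hp : ∀ x, 0 < h x) {R : ℕ} (hR : 1 ≤ R)
    (hh : ∀ x ∈ ball (0 : Zd d) R, sm h x = 2 * d * h x) {x : Zd d} (hx : 2 * nsq x ≤ (R : ℝ) ^ 2)
    (j : Fin d × Bool) : |h (x + e j) - h x| ≤ 11520 * (d : ℝ) ^ 8 / R * h x := by
  have hd' : (1 : ℝ) ≤ d := by exact_mod_cast hd
  have hR' : (1 : ℝ) ≤ R := by exact_mod_cast hR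
  have hd8 : (d : ℝ) ≤ (d : ℝ) ^ 8 := le_self_pow₀ hd' (by norm_num)
  obtain ⟨r, rfl⟩ : ∃ r, R = r + 1 := ⟨R - 1, by omega⟩
  set T : Set (Zd d) := {x | nsq x < ((r + 1 : ℕ) : ℝ) ^ 2} with hT
  have hTb : T ⊆ ball (0 : Zd d) r := fun x hx => mem_ball_of_nsq (by simpa [hT] using hx)
  have hTf : T.Finite := (ball_finite r).subset hTb
  have hxT : x ∈ T := by
    have := nsq_nonneg x
    show nsq x < ((r + 1 : ℕ) : ℝ) ^ 2
    nlinarith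
  set G : Zd d → ℝ := fun x => Q h x * (((r + 1 : ℕ) : ℝ) ^ 2 - nsq x) ^ 2 with hG
  obtain ⟨x₀, hx₀, hmax⟩ := Finset.exists_max_image hTf.toFinset G ⟨x, by simpa using hxT⟩
  simp only [Set.Finite.mem_toFinset] at hx₀ hmax
  have hx₀' : nsq x₀ < ((r + 1 : ℕ) : ℝ) ^ 2 := hx₀
  have hballmono : ball (0 : Zd d) r ⊆ ball (0 : Zd d) (r + 1) := fun x hx => by
    rw [mem_ball] at *
    intro i
    have := hx i
    push_cast; linarith
  have key : √(Q h x₀) * (((r + 1 : ℕ) : ℝ) ^ 2 - nsq x₀) ≤ 5760 * (d : ℝ) ^ 8 * ((r + 1 : ℕ) : ℝ) := by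
    set R : ℝ := ((r + 1 : ℕ) : ℝ)
    by_cases hc : 6 * R ≤ R ^ 2 - nsq x₀
    · refine max_point hd hp (hh _ (hballmono (hTb hx₀))) (fun j => hh _ (ball_add (hTb hx₀) j)) hR'
        hx₀'.le hc fun j => ?_
      refine hmax (x₀ + e j) ?_
      show nsq (x₀ + e j) < R ^ 2
      rw [nsq_add]
      have h1 := abs_le.1 (abs_le_of_sq_le_sq ((coord_le x₀ j.1).trans hx₀'.le) (by linarith))
      unfold sg
      split_ifs <;> linarith [h1.1, h1.2]
    · push Not at hc
      have h1 := Q_le hp (hh _ (hballmono (hTb hx₀)))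
      have h2 : √(Q h x₀) ≤ 2 * d := by
        rw [Real.sqrt_le_left (by positivity)]
        linarith
      calc _ ≤ 2 * (d : ℝ) * (6 * R) := by
            apply mul_le_mul h2 hc.le (by linarith) (by positivity)
        _ ≤ _ := by nlinarith
  set R : ℝ := ((r + 1 : ℕ) : ℝ)
  have h1 : G x ≤ (5760 * (d : ℝ) ^ 8 * R) ^ 2 := by
    refine (hmax x hxT).trans ?_
    have := pow_le_pow_left₀ (mul_nonneg (Real.sqrt_nonneg _) (by linarith)) key 2
    rwa [mul_pow, Real.sq_sqrt (Q_nonneg _ _)] at this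
  have h2 : √(Q h x) * (R ^ 2 / 2) ≤ 5760 * (d : ℝ) ^ 8 * R := by
    refine le_of_sq_le_sq ?_ (by positivity)
    refine le_trans ?_ h1
    rw [mul_pow, Real.sq_sqrt (Q_nonneg _ _)]
    simp only [hG]
    have := Q_nonneg h x
    gcongr
    linarith
  have h3 : √(Q h x) ≤ 11520 * (d : ℝ) ^ 8 / R := by
    rw [le_div_iff₀ (by linarith)]
    have : (√(Q h x) * R) * R ≤ (11520 * (d : ℝ) ^ 8) * R := by nlinarith
    exact le_of_mul_le_mul_right this (by linarith)
  have h4 : |F h j x - 1| ≤ √(Q h x) := by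
    refine Real.abs_le_sqrt ?_
    exact Finset.single_le_sum (f := fun i => (F h i x - 1) ^ 2) (fun i _ => sq_nonneg _)
      (Finset.mem_univ j)
  have h5 : h (x + e j) - h x = (F h j x - 1) * h x := by
    unfold F
    have := (hp x).ne'
    field_simp
  rw [h5, abs_mul, abs_of_pos (hp x)]
  exact mul_le_mul_of_nonneg_right (h4.trans h3) (hp x).le

end S5

namespace S5

/-- l1 norm -/
def l1 {d : ℕ} (x : Zd d) : ℕ := ∑ i, (x i).natAbs

lemma harnack_pos {d : ℕ} (hd : 1 ≤ d) {h : Zd d → ℝ} (hp : ∀ x, 0 < h x) {R : ℕ} (hR : 1 ≤ R)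
    (hh : ∀ x ∈ ball (0 : Zd d) R, sm h x = 2 * d * h x) (n : ℕ) :
    ∀ x : Zd d, l1 x = n → 2 * nsq x ≤ (R : ℝ) ^ 2 →
    |h x - h 0| ≤ ((1 + 11520 * (d : ℝ) ^ 8 / R) ^ n - 1) * h 0 := by
  set η : ℝ := 11520 * (d : ℝ) ^ 8 / R with hη
  have hη0 : 0 ≤ η := by positivity
  induction n with
  | zero =>
    intro x hx _
    have : x = 0 := by
      ext i
      have := Finset.sum_eq_zero_iff.1 hx i (Finset.mem_univ i)
      simpa using this
    simp [this]
  | succ n ih =>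
    intro x hx hx2
    have : ∃ i, x i ≠ 0 := by
      by_contra hc
      push Not at hc
      simp [l1, hc] at hx
    obtain ⟨i, hi⟩ := this
    obtain ⟨j, hj1, hj2⟩ : ∃ j : Fin d × Bool, j.1 = i ∧ (if j.2 then x i < 0 else 0 < x i) := by
      rcases lt_or_gt_of_ne hi with h | h
      · exact ⟨(i, true), rfl, by simpa using h⟩
      · exact ⟨(i, false), rfl, by simpa using h⟩
    set y := x + e j with hy
    have hxy : x = y + e (op j) := by rw [e_op, hy]; abel
    have hyl : l1 y = n := by
      have h1 : l1 x = l1 y + 1 := by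
        unfold l1
        rw [← Finset.add_sum_erase _ _ (Finset.mem_univ i), ← Finset.add_sum_erase _ (fun i => (y i).natAbs) (Finset.mem_univ i)]
        have h2 : ∑ k ∈ Finset.univ.erase i, (x k).natAbs = ∑ k ∈ Finset.univ.erase i, (y k).natAbs := by
          refine Finset.sum_congr rfl fun k hk => ?_
          have : k ≠ i := (Finset.mem_erase.1 hk).1
          simp [hy, e_apply, hj1, this]
        have h3 : (x i).natAbs = (y i).natAbs + 1 := by
          simp only [hy, Pi.add_apply, e_apply, hj1, if_true]
          split_ifs at * <;> omega
        rw [h2, h3]; ring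
      omega
    have hyn : nsq y ≤ nsq x := by
      rw [hy, nsq_add, hj1]
      unfold sg
      split_ifs at *
      · have : (x i : ℝ) ≤ -1 := by exact_mod_cast Int.le_sub_one_of_lt hj2
        linarith
      · have : (1 : ℝ) ≤ x i := by exact_mod_cast hj2
        linarith
    have h1 := ih y hyl (by linarith)
    have h2 := grad hd hp hR hh (x := y) (by linarith) (op j)
    rw [← hxy, ← hη] at h2
    have h3 := abs_le.1 h1
    have h4 : η * h y ≤ η * ((1 + η) ^ n * h 0) := by
      apply mul_le_mul_of_nonneg_left _ hη0
      linarith [h3.2]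
    calc |h x - h 0| ≤ |h x - h y| + |h y - h 0| := abs_sub_le _ _ _
      _ ≤ η * ((1 + η) ^ n * h 0) + ((1 + η) ^ n - 1) * h 0 := by linarith
      _ = _ := by ring

lemma harnack {d : ℕ} (hd : 1 ≤ d) {h : Zd d → ℝ} (hp : ∀ x, 0 ≤ h x) {R r : ℕ} (hR : 1 ≤ R)
    (hh : ∀ x ∈ ball (0 : Zd d) R, sm h x = 2 * d * h x)
    (hr : 11520 * (d : ℝ) ^ 9 * r ≤ R) {x : Zd d} (hx : x ∈ ball (0 : Zd d) r) :
    |h x - h 0| ≤ 23040 * (d : ℝ) ^ 9 * r / R * h 0 := by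
  have hd' : (1 : ℝ) ≤ d := by exact_mod_cast hd
  have hR' : (1 : ℝ) ≤ R := by exact_mod_cast hR
  set t : ℝ := 11520 * (d : ℝ) ^ 9 * r / R with ht
  have ht0 : 0 ≤ t := by positivity
  have ht1 : t ≤ 1 := by rw [ht, div_le_one (by linarith)]; exact hr
  have hnsq : 2 * nsq x ≤ (R : ℝ) ^ 2 := by
    have h1 := nsq_le_of_ball hx
    have h2 := pow_le_pow_left₀ (by positivity) hr 2
    have h3 : (d : ℝ) ≤ d ^ 18 := le_self_pow₀ hd' (by norm_num)
    have h4 : 2 * (d * (r : ℝ) ^ 2) ≤ (11520 * (d : ℝ) ^ 9 * r) ^ 2 := by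
      calc 2 * (d * (r : ℝ) ^ 2) ≤ 11520 ^ 2 * (d ^ 18 * (r : ℝ) ^ 2) := by
            gcongr; norm_num
        _ = _ := by ring
    linarith
  have hl1 : (l1 x : ℝ) ≤ d * r := by
    rw [mem_ball] at hx
    have : l1 x ≤ ∑ i : Fin d, r := Finset.sum_le_sum fun i _ => by
      have := hx i; rw [abs_le] at this; omega
    simp at this
    exact_mod_cast this
  have key : ∀ ε : ℝ, 0 < ε → |h x - h 0| ≤ 2 * t * (h 0 + ε) := by
    intro ε hε
    have h1 := harnack_pos hd (h := fun x => h x + ε) (fun x => by have := hp x; positivity) hR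
      (by
        intro x hx
        have := hh x hx
        unfold sm at *
        rw [Finset.sum_add_distrib, this]
        simp; ring) (l1 x) x rfl hnsq
    simp only [add_sub_add_right_eq_sub] at h1
    refine h1.trans ?_
    have h2 := hp 0
    gcongr
    have h3 : (1 + 11520 * (d : ℝ) ^ 8 / R) ^ (l1 x) ≤ Real.exp t := by
      calc _ ≤ (Real.exp (11520 * (d : ℝ) ^ 8 / R)) ^ (l1 x) := by
            gcongr
            rw [add_comm]; exact Real.add_one_le_exp _
        _ = Real.exp (l1 x * (11520 * (d : ℝ) ^ 8 / R)) := by rw [← Real.exp_nat_mul]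
        _ ≤ Real.exp t := by
            apply Real.exp_le_exp.2
            calc (l1 x : ℝ) * (11520 * (d : ℝ) ^ 8 / R) ≤ (d * r) * (11520 * (d : ℝ) ^ 8 / R) := by
                  gcongr
              _ = t := by rw [ht]; ring
    have h4 := (abs_le.1 (Real.abs_exp_sub_one_le (x := t) (by rw [abs_of_nonneg ht0]; exact ht1))).2
    rw [abs_of_nonneg ht0] at h4
    linarith
  have e1 : 23040 * (d : ℝ) ^ 9 * r / R = 2 * t := by rw [ht]; ring
  rw [e1]
  refine le_of_forall_pos_le_add fun ε hε => ?_
  have := key (ε / 2) (by positivity)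
  nlinarith

/-- The superharmonic function -/
noncomputable def w {d : ℕ} (x : Zd d) : ℝ := 1 / √(nsq x + 48)

lemma w_pos {d : ℕ} (x : Zd d) : 0 < w x := by
  have := nsq_nonneg x
  unfold w; positivity

/-- Taylor polynomial -/
noncomputable def tp (s : ℝ) : ℝ := 1 - s / 2 + 3 * s ^ 2 / 8 - 5 * s ^ 3 / 16 + s ^ 4

lemma tp_ineq {s : ℝ} (hs : |s| ≤ 1 / 2) : 1 / √(1 + s) ≤ tp s := by
  obtain ⟨h1, h2⟩ := abs_le.1 hs
  have hpos : 0 < 1 + s := by linarith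
  have htp : 0 ≤ tp s := by
    unfold tp
    nlinarith [sq_nonneg s, sq_nonneg (s^2), mul_nonneg (sq_nonneg s) (by linarith : 0 ≤ 1/2 - s)]
  rw [div_le_iff₀ (Real.sqrt_pos.2 hpos)]
  rw [← abs_of_nonneg htp, ← Real.sqrt_sq_eq_abs, ← Real.sqrt_mul (sq_nonneg _)]
  rw [Real.one_le_sqrt]
  have h3 : tp s ^ 2 * (1 + s) - 1 = s ^ 4 * (93 / 64 + 78 / 64 * s - 99 / 256 * s ^ 2
      + 57 / 256 * s ^ 3 + 3 / 8 * s ^ 4 + s ^ 5) := by unfold tp; ring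
  have h4 : s ^ 2 ≤ 1 / 4 := by nlinarith
  have h5 : -(1 / 8) ≤ s ^ 3 := by
    have : s ^ 3 = s * s ^ 2 := by ring
    rw [this]; nlinarith [sq_nonneg s]
  have h6 : -(1 / 32) ≤ s ^ 5 := by
    have : s ^ 5 = s ^ 3 * s ^ 2 := by ring
    rw [this]; nlinarith [sq_nonneg s]
  have h7 : 0 ≤ s ^ 4 := by positivity
  have h8 : 0 ≤ s ^ 4 * (93 / 64 + 78 / 64 * s - 99 / 256 * s ^ 2
      + 57 / 256 * s ^ 3 + 3 / 8 * s ^ 4 + s ^ 5) := mul_nonneg h7 (by linarith)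
  linarith

lemma pair_ineq {u t : ℝ} (hu : 0 ≤ u) (hu2 : u ≤ 1 / 48) (ht : t ^ 2 ≤ 4 * u) :
    tp (t + u) + tp (-t + u) ≤ 2 - u + 3 / 4 * t ^ 2 + 48 * u ^ 2 := by
  have : tp (t + u) + tp (-t + u) = 2 - u + 3 / 4 * u ^ 2 + 3 / 4 * t ^ 2 - 5 / 8 * (u ^ 3 + 3 * (u * t ^ 2))
    + 2 * (u ^ 4 + 6 * (u ^ 2 * t ^ 2) + t ^ 4) := by unfold tp; ring
  rw [this]
  have h1 : t ^ 4 ≤ 16 * u ^ 2 := by nlinarith [sq_nonneg t]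
  have h2 : u ^ 2 * t ^ 2 ≤ u ^ 2 := by nlinarith [sq_nonneg u]
  have h3 : u ^ 4 ≤ u ^ 2 := pow_le_pow_of_le_one hu (by linarith) (by norm_num)
  have h4 : 0 ≤ u ^ 3 := by positivity
  have h5 : 0 ≤ u * t ^ 2 := by positivity
  nlinarith [sq_nonneg u]

lemma w_super {d : ℕ} (hd : 3 ≤ d) (x : Zd d) : sm w x ≤ 2 * d * w x := by
  have hd' : (3 : ℝ) ≤ d := by exact_mod_cast hd
  set r := nsq x + 48 with hr
  have hn := nsq_nonneg x
  have hr0 : 0 < r := by linarith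
  set u := 1 / r with hu
  have hu0 : 0 < u := by positivity
  have hu1 : u ≤ 1 / 48 := by
    rw [hu]; gcongr; linarith
  have hur : u * r = 1 := by rw [hu]; field_simp
  set t : Fin d → ℝ := fun i => 2 * x i * u with ht
  have ht2 : ∀ i, t i ^ 2 ≤ 4 * u := by
    intro i
    have h1 : (x i : ℝ) ^ 2 ≤ r := (coord_le x i).trans (by linarith)
    calc t i ^ 2 = 4 * u * (u * (x i : ℝ) ^ 2) := by simp only [ht]; ring
      _ ≤ 4 * u * (u * r) := by gcongr
      _ = _ := by rw [hur, mul_one]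
  have hs : ∀ j : Fin d × Bool, |sg j * t j.1 + u| ≤ 1 / 2 := by
    intro j
    have h1 : |t j.1| ≤ 1 / 3 := by
      refine abs_le_of_sq_le_sq ?_ (by norm_num)
      have := ht2 j.1; linarith
    have := abs_le.1 h1
    rw [abs_le]
    unfold sg
    split_ifs <;> constructor <;> linarith [this.1, this.2]
  have hw : ∀ j, w (x + e j) ≤ w x * tp (sg j * t j.1 + u) := by
    intro j
    have h1 : nsq (x + e j) + 48 = r * (1 + (sg j * t j.1 + u)) := by
      rw [nsq_add]
      have : r * (1 + (sg j * t j.1 + u)) = r + (2 * sg j * x j.1 + 1) * (u * r) := by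
        simp only [ht]; ring
      rw [this, hur]; ring
    unfold w
    rw [h1, Real.sqrt_mul hr0.le, ← one_div_mul_one_div]
    gcongr
    exact tp_ineq (hs j)
  have h1 : sm w x ≤ ∑ j : Fin d × Bool, w x * tp (sg j * t j.1 + u) :=
    Finset.sum_le_sum fun j _ => hw j
  rw [← Finset.mul_sum, Fintype.sum_prod_type] at h1
  have h2 : ∑ i : Fin d, ∑ b : Bool, tp (sg ((i, b) : Fin d × Bool) * t i + u) ≤ 2 * d := by
    calc _ ≤ ∑ i : Fin d, (2 - u + 3 / 4 * t i ^ 2 + 48 * u ^ 2) := by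
          refine Finset.sum_le_sum fun i _ => ?_
          have := pair_ineq hu0.le hu1 (ht2 i)
          simpa [sg] using this
      _ = d * (2 - u + 48 * u ^ 2) + 3 / 4 * ∑ i, t i ^ 2 := by
          rw [Finset.mul_sum, Finset.sum_add_distrib, Finset.sum_add_distrib]
          simp; ring
      _ = d * (2 - u + 48 * u ^ 2) + 3 * (u - 48 * u ^ 2) := by
          have : ∑ i, t i ^ 2 = 4 * u ^ 2 * nsq x := by
            unfold nsq
            rw [Finset.mul_sum]
            refine Finset.sum_congr rfl fun i _ => ?_
            simp only [ht]; ring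
          rw [this]
          have : nsq x = r - 48 := by rw [hr]; ring
          rw [this]
          have : u ^ 2 * r = u := by rw [sq, mul_assoc, hur, mul_one]
          linear_combination 3 * this
      _ ≤ _ := by
          have : 0 ≤ (d - 3 : ℝ) * (u * (1 - 48 * u)) := by
            apply mul_nonneg (by linarith) (mul_nonneg hu0.le (by linarith))
          nlinarith
  have h3 := mul_le_mul_of_nonneg_left h2 (w_pos x).le
  simp only at h1
  linarith

/-- ratio bound -/
lemma w_ratio {d : ℕ} {x y : Zd d} {L n : ℕ} (hL : 1 ≤ L) (hn : 1 ≤ n) (hx : x ∉ ball (0 : Zd d) (n * L))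
    (hy : y ∈ ball (0 : Zd d) L) : w x ≤ (d + 48) / n * w y := by
  have hL' : (1 : ℝ) ≤ L := by exact_mod_cast hL
  have hn' : (1 : ℝ) ≤ n := by exact_mod_cast hn
  have h1 := nsq_ge_of_not_ball hx
  have h2 := nsq_le_of_ball hy
  push_cast at h1
  have h3 : nsq y + 48 ≤ (d + 48) ^ 2 * (L : ℝ) ^ 2 := by
    have : (d : ℝ) * L ^ 2 + 48 ≤ (d + 48) * L ^ 2 := by nlinarith
    have : (d + 48 : ℝ) * L ^ 2 ≤ (d + 48) ^ 2 * L ^ 2 := by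
      gcongr
      have : (0 : ℝ) ≤ d := by positivity
      nlinarith
    linarith
  have hy0 := nsq_nonneg y
  have hx0 := nsq_nonneg x
  have h4 : √(nsq y + 48) ≤ (d + 48) * L := by
    rw [Real.sqrt_le_left (by positivity), mul_pow]; exact h3
  have h5 : n * L ≤ √(nsq x + 48) := by
    apply Real.le_sqrt_of_sq_le; linarith
  unfold w
  rw [div_mul_div_comm, mul_one, div_le_div_iff₀ (by positivity) (by positivity), one_mul]
  have h6 : 0 < √(nsq y + 48) := by positivity
  calc (n : ℝ) * √(nsq y + 48) ≤ n * ((d + 48) * L) := by gcongr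
    _ = (d + 48) * (n * L) := by ring
    _ ≤ _ := by gcongr

end S5

namespace S5

/-- Analytic core: comparison -/
lemma core {d : ℕ} (hd : 1 ≤ d) {L K M : ℕ} (hL : 1 ≤ L) (hM : 2 ≤ M) {A U : Set (Zd d)}
    (hA : A ⊆ ball (0 : Zd d) L) (hU : U = ball (0 : Zd d) (K * L))
    (hKM : 23040 * (d : ℝ) ^ 9 * M ≤ K) {ε : ℝ}
    (hε : 46080 * (d : ℝ) ^ 9 * M / K ≤ ε)
    {h f p : Zd d → ℝ}
    (h0 : ∀ x, 0 ≤ h x)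
    (hh : ∀ x ∈ U, sm h x = 2 * d * h x)
    (hf : ∀ x ∈ U, x ∉ A → sm f x = 2 * d * f x)
    (hpp : ∀ x, x ∉ A → sm p x = 2 * d * p x)
    (hfA : ∀ x ∈ A, f x = 0) (hpA : ∀ x ∈ A, p x = 0)
    (hfh : ∀ x, x ∉ U → f x = h x)
    (hp1 : ∀ x, p x ≤ 1)
    (hpU : ∀ x, x ∉ U → 1 - p x ≤ ε)
    (hpM : ∀ x, x ∉ ball (0 : Zd d) (M * L) → 1 / 2 ≤ p x)
    {y : Zd d} (hy : y ∈ A) :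
    (1 - 4 * ε) * (h 0 * sm p y) ≤ sm f y ∧ sm f y ≤ (1 + 4 * ε) * (h 0 * sm p y) := by
  have hd' : (1 : ℝ) ≤ d := by exact_mod_cast hd
  have hL' : (1 : ℝ) ≤ L := by exact_mod_cast hL
  have hM' : (2 : ℝ) ≤ M := by exact_mod_cast hM
  have hd9 : (1 : ℝ) ≤ (d : ℝ) ^ 9 := one_le_pow₀ hd'
  have hMK : 23040 * (M : ℝ) ≤ K := by nlinarith
  have hK0 : (0 : ℝ) < K := by linarith
  have hKMn : M + 1 ≤ K := by
    have : ((M + 1 : ℕ) : ℝ) ≤ K := by push_cast; linarith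
    exact_mod_cast this
  have hε0 : 0 ≤ ε := le_trans (by positivity) hε
  have hmono : ∀ {r s : ℕ}, r ≤ s → ball (0 : Zd d) r ⊆ ball (0 : Zd d) s := by
    intro r s hrs x hx
    rw [mem_ball] at *
    intro i; have := hx i
    have : (r : ℤ) ≤ s := by exact_mod_cast hrs
    linarith
  have hMLU : ball (0 : Zd d) (M * L + 1) ⊆ U := by
    rw [hU]; apply hmono; nlinarith
  have hLM : L + 1 ≤ M * L := by nlinarith
  have hAU : A ⊆ U := hA.trans ((hmono (by omega)).trans hMLU)
  have hK1 : 1 ≤ K * L := Nat.mul_pos (by omega) hL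
  -- Harnack
  have hH : ∀ x ∈ ball (0 : Zd d) (M * L + 1), |h x - h 0| ≤ ε * h 0 := by
    intro x hx
    have hr : ((M * L + 1 : ℕ) : ℝ) ≤ 2 * M * L := by
      push_cast; nlinarith
    have h1 := harnack hd h0 hK1 (r := M * L + 1) (fun x hx => hh x (by rw [hU]; exact hx)) (by
      calc 11520 * (d : ℝ) ^ 9 * ((M * L + 1 : ℕ) : ℝ) ≤ 11520 * (d : ℝ) ^ 9 * (2 * M * L) := by gcongr
        _ = 23040 * (d : ℝ) ^ 9 * M * L := by ring
        _ ≤ K * L := by gcongr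
        _ = ((K * L : ℕ) : ℝ) := by push_cast; rfl) hx
    refine h1.trans (mul_le_mul_of_nonneg_right (le_trans ?_ hε) (h0 0))
    calc 23040 * (d : ℝ) ^ 9 * ((M * L + 1 : ℕ) : ℝ) / ((K * L : ℕ) : ℝ)
        ≤ 23040 * (d : ℝ) ^ 9 * (2 * M * L) / ((K * L : ℕ) : ℝ) := by gcongr
      _ = _ := by push_cast; field_simp; ring
  set H := h 0 with hHdef
  have hH0 : 0 ≤ H := h0 0
  -- linearity
  have lin : ∀ (a b c k : ℝ) (x : Zd d), sm (fun x => a * h x + b * f x + c * p x + k) x =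
      a * sm h x + b * sm f x + c * sm p x + 2 * d * k := by
    intro a b c k x
    unfold sm
    rw [Finset.sum_add_distrib, Finset.sum_add_distrib, Finset.sum_add_distrib, Finset.mul_sum,
      Finset.mul_sum, Finset.mul_sum]
    simp only [Finset.sum_const, Finset.card_univ, Fintype.card_prod, Fintype.card_fin,
      Fintype.card_bool, nsmul_eq_mul]
    push_cast; ring
  -- step 1
  have hUf : (U \ A).Finite := ((by rw [hU]; exact ball_finite _ : U.Finite)).subset Set.sdiff_subset
  have hV : ∀ x ∈ U, |h x - f x - H * (1 - p x)| ≤ ε * H := by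
    intro x hx
    by_cases hxA : x ∈ A
    · rw [hfA x hxA, hpA x hxA]
      have := hH x (hmono (by omega) (hA hxA))
      simpa using this
    · have bd : ∀ z, z ∉ U \ A → |h z - f z - H * (1 - p z)| ≤ ε * H := by
        intro z hz
        by_cases hzA : z ∈ A
        · rw [hfA z hzA, hpA z hzA]
          have := hH z (hmono (by omega) (hA hzA))
          simpa using this
        · have hzU : z ∉ U := fun h => hz ⟨h, hzA⟩
          rw [hfh z hzU]
          have h1 := hpU z hzU
          have h2 := hp1 z
          have : h z - h z - H * (1 - p z) = -(H * (1 - p z)) := by ring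
          rw [this, abs_neg, abs_of_nonneg (mul_nonneg hH0 (by linarith)), mul_comm]
          gcongr
      have m1 := max_principle hd (U \ A) hUf (fun x => 1 * h x + (-1) * f x + H * p x + (-H - ε * H))
        (by
          intro z hz
          rw [lin, hh z hz.1, hf z hz.1 hz.2, hpp z hz.2]
          apply le_of_eq; ring)
        (by
          intro z _ j hj
          have := (abs_le.1 (bd _ hj)).2
          linarith) x ⟨hx, hxA⟩
      have m2 := max_principle hd (U \ A) hUf (fun x => (-1) * h x + 1 * f x + (-H) * p x + (H - ε * H))
        (by
          intro z hz
          rw [lin, hh z hz.1, hf z hz.1 hz.2, hpp z hz.2]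
          apply le_of_eq; ring)
        (by
          intro z _ j hj
          have := (abs_le.1 (bd _ hj)).1
          linarith) x ⟨hx, hxA⟩
      rw [abs_le]
      constructor <;> linarith
  -- step 2
  have hbd : ∀ x ∈ ball (0 : Zd d) (M * L + 1), x ∉ ball (0 : Zd d) (M * L) →
      |f x - H * p x| ≤ 4 * ε * (H * p x) := by
    intro x hx hx2
    have h1 := abs_le.1 (hV x (hMLU hx))
    have h2 := abs_le.1 (hH x hx)
    have h3 := hpM x hx2
    have h4 : ε * H ≤ 2 * (ε * (H * p x)) := by
      have : 0 ≤ ε * H := by positivity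
      nlinarith
    rw [abs_le]
    constructor <;> linarith [h1.1, h1.2, h2.1, h2.2]
  have hTf : (ball (0 : Zd d) (M * L) \ A).Finite := (ball_finite _).subset Set.sdiff_subset
  have hTU : ball (0 : Zd d) (M * L) ⊆ U := (hmono (by omega)).trans hMLU
  have hbd2 : ∀ x ∈ ball (0 : Zd d) (M * L) \ A, ∀ j, x + e j ∉ ball (0 : Zd d) (M * L) \ A →
      |f (x + e j) - H * p (x + e j)| ≤ 4 * ε * (H * p (x + e j)) := by
    intro x hx j hj
    by_cases hA' : x + e j ∈ A
    · rw [hfA _ hA', hpA _ hA']; simp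
    · exact hbd _ (ball_add hx.1 j) fun hc => hj ⟨hc, hA'⟩
  have hfin : ∀ x ∈ ball (0 : Zd d) (M * L), (1 - 4 * ε) * (H * p x) ≤ f x ∧
      f x ≤ (1 + 4 * ε) * (H * p x) := by
    intro x hx
    by_cases hxA : x ∈ A
    · rw [hfA _ hxA, hpA _ hxA]; simp
    have m1 := max_principle hd _ hTf (fun x => 0 * h x + 1 * f x + (-((1 + 4 * ε) * H)) * p x + 0)
      (by
        intro z hz
        rw [lin, hf z (hTU hz.1) hz.2, hpp z hz.2]
        apply le_of_eq; ring)
      (by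
        intro z hz j hj
        have := (abs_le.1 (hbd2 z hz j hj)).2
        linarith) x ⟨hx, hxA⟩
    have m2 := max_principle hd _ hTf (fun x => 0 * h x + (-1) * f x + ((1 - 4 * ε) * H) * p x + 0)
      (by
        intro z hz
        rw [lin, hf z (hTU hz.1) hz.2, hpp z hz.2]
        apply le_of_eq; ring)
      (by
        intro z hz j hj
        have := (abs_le.1 (hbd2 z hz j hj)).1
        linarith) x ⟨hx, hxA⟩
    constructor <;> linarith
  have hnb : ∀ j, y + e j ∈ ball (0 : Zd d) (M * L) := fun j => hmono hLM (ball_add (hA hy) j)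
  unfold sm
  rw [Finset.mul_sum, Finset.mul_sum, Finset.mul_sum]
  exact ⟨Finset.sum_le_sum fun j _ => (hfin _ (hnb j)).1,
    Finset.sum_le_sum fun j _ => (hfin _ (hnb j)).2⟩

end S5

namespace S5

section det
variable {d : ℕ} {Ω : Type*} [MeasurableSpace Ω] (W : SRW d Ω)

/-- good trajectories -/
def good (ω : Ω) : Prop := (∀ n, 0 < W.ζ n ω) ∧ ∀ m, ∃ i, m ≤ i ∧ 1 < W.ζ i ω

variable {W} {ω : Ω}

lemma S_succ (n : ℕ) : W.S (n + 1) ω = W.S n ω + W.ζ n ω := by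
  simp [SRW.S, Finset.sum_range_succ]

lemma S_zero : W.S 0 ω = 0 := by simp [SRW.S]

lemma S_strictMono (hg : good W ω) : StrictMono (fun n => W.S n ω) :=
  strictMono_nat_of_lt_succ fun n => by
    have := hg.1 n
    simp only [S_succ]; linarith

lemma S_nonneg (hg : good W ω) (n : ℕ) : 0 ≤ W.S n ω := by
  have := (S_strictMono hg).monotone (Nat.zero_le n)
  simpa [S_zero] using this

lemma S_unbdd (hg : good W ω) (k : ℕ) : ∃ n, (k : ℝ) ≤ W.S n ω := by
  induction k with
  | zero => exact ⟨0, by simp [S_zero]⟩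
  | succ k ih =>
    obtain ⟨n, hn⟩ := ih
    obtain ⟨i, hi, hi2⟩ := hg.2 n
    refine ⟨i + 1, ?_⟩
    have : W.S n ω ≤ W.S i ω := (S_strictMono hg).monotone hi
    rw [S_succ]; push_cast; linarith

lemma exists_idx (hg : good W ω) {t : ℝ} (ht : 0 ≤ t) : ∃ k, W.S k ω ≤ t ∧ t < W.S (k + 1) ω := by
  obtain ⟨K, hK⟩ := exists_nat_gt t
  obtain ⟨n, hn⟩ := S_unbdd hg K
  have hex : ∃ n, t < W.S n ω := ⟨n, by linarith⟩
  have h1 := Nat.find_spec hex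
  have h2 : Nat.find hex ≠ 0 := by
    intro h0
    rw [h0, S_zero] at h1; linarith
  obtain ⟨m, hm⟩ := Nat.exists_eq_succ_of_ne_zero h2
  refine ⟨m, ?_, by rw [hm] at h1; exact h1⟩
  exact not_lt.1 (Nat.find_min hex (by omega))

lemma jumpIdx_eq (hg : good W ω) {t : ℝ} {k : ℕ} (h1 : W.S k ω ≤ t) (h2 : t < W.S (k + 1) ω) :
    W.jumpIdx t ω = k := by
  have : {k' : ℕ | W.S k' ω ≤ t} = Set.Iic k := by
    ext k'
    constructor
    · intro (h : W.S k' ω ≤ t)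
      have : W.S k' ω < W.S (k + 1) ω := by linarith
      have := (S_strictMono hg).lt_iff_lt.1 this
      simp; omega
    · intro (h : k' ≤ k)
      exact le_trans ((S_strictMono hg).monotone h) h1
  unfold SRW.jumpIdx
  rw [this]; exact csSup_Iic

lemma X_S (hg : good W ω) (k : ℕ) : W.X (W.S k ω) ω = W.Y k ω := by
  unfold SRW.X
  rw [jumpIdx_eq hg le_rfl]
  rw [S_succ]; linarith [hg.1 k]

lemma hitFrom_top (hg : good W ω) (A : Set (Zd d)) (m : ℕ) :
    W.hitFrom A (ENNReal.ofReal (W.S m ω)) ω = ⊤ ↔ ∀ k, m ≤ k → W.Y k ω ∉ A := by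
  unfold SRW.hitFrom
  rw [sInf_eq_top]
  constructor
  · intro h k hk hA
    have h1 := h ((W.S k ω).toNNReal : ℝ≥0∞) ⟨(W.S k ω).toNNReal, rfl, ?_, ?_⟩
    · simp at h1
    · exact ENNReal.ofReal_le_ofReal ((S_strictMono hg).monotone hk)
    · rw [Real.coe_toNNReal _ (S_nonneg hg k), X_S hg]; exact hA
  · rintro h u ⟨s, rfl, hs, hA⟩
    exfalso
    obtain ⟨k, hk1, hk2⟩ := exists_idx hg s.2
    have hk1' : W.S k ω ≤ (s : ℝ) := hk1
    have hk2' : (s : ℝ) < W.S (k + 1) ω := hk2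
    unfold SRW.X at hA
    rw [jumpIdx_eq hg hk1' hk2'] at hA
    refine h k ?_ hA
    have h3 : W.S m ω ≤ s := by
      have := ENNReal.toReal_mono (by simp) hs
      rwa [ENNReal.toReal_ofReal (S_nonneg hg m), ENNReal.coe_toReal] at this
    have : W.S m ω < W.S (k + 1) ω := by linarith
    have := (S_strictMono hg).lt_iff_lt.1 this
    omega

lemma hitTilde_top (hg : good W ω) (A : Set (Zd d)) :
    W.hitTilde A ω = ⊤ ↔ ∀ k, W.Y (k + 1) ω ∉ A := by
  unfold SRW.hitTilde
  have : W.ζ 0 ω = W.S 1 ω := by rw [S_succ, S_zero, zero_add]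
  rw [this, hitFrom_top hg]
  constructor
  · intro h k; exact h _ (by omega)
  · intro h k hk
    obtain ⟨k, rfl⟩ : ∃ l, k = l + 1 := ⟨k - 1, by omega⟩
    exact h k

lemma exit_eq (hg : good W ω) (U : Set (Zd d)) {m : ℕ} (h1 : W.Y m ω ∉ U)
    (h2 : ∀ k < m, W.Y k ω ∈ U) : W.exit U ω = ENNReal.ofReal (W.S m ω) := by
  unfold SRW.exit SRW.hit SRW.hitFrom
  apply le_antisymm
  · refine sInf_le ⟨(W.S m ω).toNNReal, rfl, by simp, ?_⟩
    rw [Real.coe_toNNReal _ (S_nonneg hg m), X_S hg]; exact h1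
  · refine le_sInf ?_
    rintro u ⟨s, rfl, -, hA⟩
    obtain ⟨k, hk1, hk2⟩ := exists_idx hg s.2
    have hk1' : W.S k ω ≤ (s : ℝ) := hk1
    have hk2' : (s : ℝ) < W.S (k + 1) ω := hk2
    unfold SRW.X at hA
    rw [jumpIdx_eq hg hk1' hk2'] at hA
    have hmk : m ≤ k := by
      by_contra hc
      exact hA (h2 k (by omega))
    rw [ENNReal.ofReal_le_iff_le_toReal (by simp)]
    exact le_trans ((S_strictMono hg).monotone hmk) hk1'

lemma exit_top (hg : good W ω) (U : Set (Zd d)) (h : ∀ k, W.Y k ω ∈ U) : W.exit U ω = ⊤ := by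
  have := (hitFrom_top hg Uᶜ 0).2 (fun k _ => by simpa using h k)
  rw [S_zero, ENNReal.ofReal_zero] at this
  exact this

/-- path events -/
def NA (A : Set (Zd d)) : Set (ℕ → Zd d) := {p | ∀ k, p k ∉ A}

/-- the event defining `q` on paths -/
def GE (A B U : Set (Zd d)) : Set (ℕ → Zd d) :=
  {p | ∃ m, p m ∉ U ∧ (∀ k < m, p k ∈ U) ∧ (∃ k, m ≤ k ∧ p k ∈ B \ A) ∧ ∀ k, m ≤ k → p k ∉ A}

lemma event_iff (hg : good W ω) (A B U : Set (Zd d)) :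
    (W.hitFrom (B \ A) (W.exit U ω) ω < ⊤ ∧ W.hitFrom A (W.exit U ω) ω = ⊤) ↔
      (fun n => W.Y n ω) ∈ GE A B U := by
  by_cases hex : ∃ m, W.Y m ω ∉ U
  · have h1 := Nat.find_spec hex
    have h2 : ∀ k < Nat.find hex, W.Y k ω ∈ U := fun k hk => not_not.1 (Nat.find_min hex hk)
    set m := Nat.find hex with hm
    rw [exit_eq hg U h1 h2, lt_top_iff_ne_top, Ne, hitFrom_top hg, hitFrom_top hg]
    constructor
    · rintro ⟨h3, h4⟩
      push Not at h3
      exact ⟨m, h1, h2, h3, h4⟩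
    · rintro ⟨m', h1', h2', h3, h4⟩
      have : m' = m := by
        rcases lt_trichotomy m' m with h | h | h
        · exact absurd (h2 m' h) h1'
        · exact h
        · exact absurd (h2' m h) h1
      subst this
      refine ⟨?_, h4⟩
      push Not
      exact h3
  · push Not at hex
    rw [exit_top hg U hex]
    constructor
    · rintro ⟨h, -⟩
      exfalso
      unfold SRW.hitFrom at h
      rw [sInf_lt_iff] at h
      obtain ⟨u, ⟨s, rfl, hs, -⟩, -⟩ := h
      simp at hs
    · rintro ⟨m, hm, -⟩
      exact absurd (hex m) hm

end det

end S5

namespace S5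

lemma e_inj {d : ℕ} : Function.Injective (e (d := d)) := by
  intro j k h
  have h1 := congrFun h j.1
  rw [e_apply, e_apply] at h1
  rcases j with ⟨i, b⟩
  rcases k with ⟨i', b'⟩
  simp only [if_true] at h1
  by_cases hi : i = i'
  · subst hi
    cases b <;> cases b' <;> simp_all
  · cases b <;> simp_all

lemma natAbs_sum_one {d : ℕ} (v : Zd d) : (∑ i, (v i).natAbs) = 1 ↔ ∃ j, v = e j := by
  constructor
  · intro h
    have hex : ∃ i, v i ≠ 0 := by
      by_contra hc
      push Not at hc
      simp [hc] at h
    obtain ⟨i, hi⟩ := hex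
    have h2 := Finset.add_sum_erase Finset.univ (fun i => (v i).natAbs) (Finset.mem_univ i)
    have h3 : 1 ≤ (v i).natAbs := by omega
    have h4 : ∑ k ∈ Finset.univ.erase i, (v k).natAbs = 0 := by omega
    have h5 : (v i).natAbs = 1 := by omega
    rw [Finset.sum_eq_zero_iff] at h4
    refine ⟨(i, decide (0 < v i)), ?_⟩
    ext k
    rw [e_apply]
    by_cases hk : k = i
    · subst hk
      by_cases h0 : 0 < v k
      · simp [h0]; omega
      · simp [h0]; omega
    · have := h4 k (by simp [hk])
      simp [hk]; omega
  · rintro ⟨j, rfl⟩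
    rw [Finset.sum_eq_single j.1]
    · rw [e_apply]; cases j.2 <;> simp
    · intro i _ hi; rw [e_apply]; simp [hi]
    · simp

lemma stepP_eq {d : ℕ} (v : Zd d) :
    stepP d v = ∑ j : Fin d × Bool, ((2 * d : ℕ) : ℝ≥0∞)⁻¹ * (if v = e j then 1 else 0) := by
  unfold stepP
  split_ifs with h
  · obtain ⟨j, rfl⟩ := (natAbs_sum_one v).1 h
    rw [Finset.sum_eq_single j]
    · simp
    · intro k _ hk
      rw [if_neg (fun h => hk (e_inj h).symm)]; simp
    · simp
  · symm
    refine Finset.sum_eq_zero fun j _ => ?_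
    rw [if_neg (fun h' => h ((natAbs_sum_one v).2 ⟨j, h'⟩))]; simp

lemma exp_Ioi (a : ℝ) (ha : 0 ≤ a) : expMeasure (Ioi a) = ENNReal.ofReal (Real.exp (-a)) := by
  unfold expMeasure
  rw [withDensity_apply _ measurableSet_Ioi]
  rw [setLIntegral_congr_fun (g := fun t => ENNReal.ofReal (Real.exp (-t))) measurableSet_Ioi]
  · rw [← ofReal_integral_eq_lintegral_ofReal]
    · rw [integral_exp_neg_Ioi]
    · exact integrableOn_exp_neg_Ioi a
    · exact Filter.Eventually.of_forall fun t => (Real.exp_pos _).le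
  · intro t ht
    simp only
    rw [if_pos (lt_of_le_of_lt ha ht)]

lemma exp_Iic0 : expMeasure (Iic 0) = 0 := by
  unfold expMeasure
  rw [withDensity_apply _ measurableSet_Iic]
  rw [setLIntegral_congr_fun (g := fun t => 0) measurableSet_Iic]
  · simp
  · intro t ht
    simp only
    rw [if_neg (not_lt.2 ht)]; simp

lemma exp_univ : expMeasure univ = 1 := by
  rw [← Iic_union_Ioi (a := (0:ℝ)), measure_union (Set.disjoint_left.2
    fun x hx hx' => (not_le.2 (mem_Ioi.1 hx')) (mem_Iic.1 hx)) measurableSet_Ioi, exp_Iic0, exp_Ioi 0 le_rfl]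
  simp

instance : IsProbabilityMeasure expMeasure := ⟨exp_univ⟩

lemma exp_Iic1 : expMeasure (Iic 1) < 1 := by
  rw [← compl_Ioi, prob_compl_eq_one_sub measurableSet_Ioi, exp_Ioi 1 (by norm_num)]
  refine ENNReal.sub_lt_self (by simp) (by simp) ?_
  simp [Real.exp_pos]

variable {d : ℕ} {Ω : Type*} [MeasurableSpace Ω]

lemma zeta_law (W : SRW d Ω) (x : Zd d) (n : ℕ) (I : Fin n → Set ℝ) (hI : ∀ i, MeasurableSet (I i)) :
    W.P x {ω | ∀ i : Fin n, W.ζ i ω ∈ I i} ≤ ∏ i, expMeasure (I i) := by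
  have := W.isProb x
  have h1 : {ω | ∀ i : Fin n, W.ζ i ω ∈ I i} ⊆ ⋃ s : Fin n → Zd d,
      {ω | (∀ i : Fin n, W.Y ((i : ℕ) + 1) ω - W.Y (i : ℕ) ω = s i) ∧
             (∀ i : Fin n, W.ζ (i : ℕ) ω ∈ I i)} := by
    intro ω hω
    exact mem_iUnion.2 ⟨fun i => W.Y ((i : ℕ) + 1) ω - W.Y (i : ℕ) ω, fun i => rfl, hω⟩
  have h2 : ∑' s : Fin n → Zd d, ∏ i, stepP d (s i) ≤ 1 := by
    have h3 : ∀ s : Fin n → Zd d, ∏ i, stepP d (s i) =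
      W.P x {ω | (∀ i : Fin n, W.Y ((i : ℕ) + 1) ω - W.Y (i : ℕ) ω = s i) ∧
             (∀ i : Fin n, W.ζ (i : ℕ) ω ∈ (univ : Set ℝ))} := by
      intro s
      rw [W.law x n s (fun _ => univ) (fun _ => MeasurableSet.univ)]
      simp [exp_univ]
    simp_rw [h3]
    rw [← measure_univ (μ := W.P x)]
    refine tsum_meas_le_meas_iUnion_of_disjoint (W.P x) ?_ ?_ |>.trans (measure_mono (subset_univ _))
    · intro s
      simp only [mem_univ, implies_true, and_true]
      have : {ω | ∀ i : Fin n, W.Y ((i : ℕ) + 1) ω - W.Y (i : ℕ) ω = s i} =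
        ⋂ i : Fin n, {ω | W.Y ((i : ℕ) + 1) ω - W.Y (i : ℕ) ω = s i} := by ext; simp
      rw [this]
      refine MeasurableSet.iInter fun i => ?_
      exact ((W.measurable_Y _).sub (W.measurable_Y _)) (measurableSet_singleton (s i))
    · intro s t hst
      rw [Function.onFun, Set.disjoint_left]
      rintro ω ⟨h, _⟩ ⟨h', _⟩
      exact hst (funext fun i => (h i).symm.trans (h' i))
  calc _ ≤ _ := measure_mono h1
    _ ≤ _ := measure_iUnion_le _
    _ = ∑' s : Fin n → Zd d, (∏ i, stepP d (s i)) * ∏ i, expMeasure (I i) := by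
      congr 1; ext s; exact W.law x n s I hI
    _ = (∑' s : Fin n → Zd d, ∏ i, stepP d (s i)) * ∏ i, expMeasure (I i) := ENNReal.tsum_mul_right
    _ ≤ 1 * ∏ i, expMeasure (I i) := by gcongr
    _ = _ := one_mul _

lemma ae_good (W : SRW d Ω) (x : Zd d) : ∀ᵐ ω ∂W.P x, good W ω := by
  have h1 : ∀ᵐ ω ∂W.P x, ∀ n, 0 < W.ζ n ω := by
    rw [ae_all_iff]
    intro n
    rw [ae_iff]
    have := zeta_law W x (n+1) (fun i => if (i:ℕ) = n then Iic 0 else univ) (by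
      intro i; split_ifs <;> measurability)
    refine le_antisymm ((measure_mono ?_).trans (this.trans ?_)) bot_le
    · intro ω hω i
      simp only [mem_ofPred_eq, not_lt] at hω
      by_cases hi : (i:ℕ) = n
      · simp [hi, hω]
      · simp [hi]
    · rw [Finset.prod_eq_zero (Finset.mem_univ (Fin.last n))]
      simp [exp_Iic0]
  have h2 : ∀ᵐ ω ∂W.P x, ∀ m, ∃ i, m ≤ i ∧ 1 < W.ζ i ω := by
    rw [ae_all_iff]
    intro m
    rw [ae_iff]
    have hk : ∀ k : ℕ, W.P x {ω | ¬ ∃ i, m ≤ i ∧ 1 < W.ζ i ω} ≤ (expMeasure (Iic 1)) ^ k := by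
      intro k
      have := zeta_law W x (m+k) (fun i => if (i:ℕ) < m then univ else Iic 1) (by
        intro i; split_ifs <;> measurability)
      refine (measure_mono ?_).trans (this.trans ?_)
      · intro ω hω i
        simp only [mem_ofPred_eq, not_exists, not_and, not_lt] at hω
        by_cases hi : (i:ℕ) < m
        · simp [hi]
        · simp only [hi, if_false]; exact hω i (by omega)
      · rw [Fin.prod_univ_add]
        simp [exp_univ]
    exact le_antisymm (ge_of_tendsto' (ENNReal.tendsto_pow_atTop_nhds_zero_of_lt_one exp_Iic1) hk) bot_le
  filter_upwards [h1, h2] with ω a b using ⟨a, b⟩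

lemma ext_path (μ ν : Measure (ℕ → Zd d)) [IsFiniteMeasure μ] [IsFiniteMeasure ν]
    (h : ∀ (n : ℕ) (s : ℕ → Zd d), μ {p | ∀ k ≤ n, p k = s k} = ν {p | ∀ k ≤ n, p k = s k}) :
    μ = ν := by
  refine IsProjectiveLimit.unique (P := fun I => ν.map I.restrict) ?_ (fun I => rfl)
  have key : ∀ n : ℕ, μ.map (Finset.Iic n).restrict = ν.map (Finset.Iic n).restrict := by
    intro n
    refine Measure.ext_of_singleton fun a => ?_
    rw [Measure.map_apply (Finset.measurable_restrict _) (measurableSet_singleton _),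
      Measure.map_apply (Finset.measurable_restrict _) (measurableSet_singleton _)]
    have : (fun p : ℕ → Zd d => (Finset.Iic n).restrict p) ⁻¹' {a} =
      {p : ℕ → Zd d | ∀ k ≤ n, p k = (fun k => if h : k ∈ Finset.Iic n then a ⟨k, h⟩ else 0) k} := by
      ext p
      simp only [mem_preimage, mem_singleton_iff, mem_ofPred_eq]
      constructor
      · rintro rfl k hk
        simp [hk]
      · intro h
        ext1 ⟨k, hk⟩
        have := h k (Finset.mem_Iic.1 hk)
        simp only [hk, dif_pos] at this
        simpa using this
    rw [this]
    exact h n _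
  intro I
  have hI : I ⊆ Finset.Iic (I.sup id) := fun i hi => Finset.mem_Iic.2 (Finset.le_sup (f := id) hi)
  have : (I.restrict : (ℕ → Zd d) → _) = Finset.restrict₂ hI ∘ (Finset.Iic (I.sup id)).restrict := rfl
  show μ.map I.restrict = ν.map I.restrict
  rw [this, ← Measure.map_map (Finset.measurable_restrict₂ _) (Finset.measurable_restrict _),
    ← Measure.map_map (Finset.measurable_restrict₂ _) (Finset.measurable_restrict _), key]

end S5

namespace S5

variable {d : ℕ} {Ω : Type*} [MeasurableSpace Ω]

/-- path map -/
def pth (W : SRW d Ω) (ω : Ω) : ℕ → Zd d := fun n => W.Y n ω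

lemma pth_meas (W : SRW d Ω) : Measurable (pth W) := measurable_pi_iff.2 W.measurable_Y

/-- law of the jump chain -/
noncomputable def nu (W : SRW d Ω) (x : Zd d) : Measure (ℕ → Zd d) := (W.P x).map (pth W)

instance (W : SRW d Ω) (x : Zd d) : IsProbabilityMeasure (nu W x) := by
  have := W.isProb x
  exact Measure.isProbabilityMeasure_map (pth_meas W).aemeasurable

/-- shift -/
def shf (p : ℕ → Zd d) : ℕ → Zd d := fun n => p (n + 1)

lemma shf_meas : Measurable (shf (d := d)) := measurable_pi_iff.2 fun n => measurable_pi_apply (n+1)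

lemma nu_zero (W : SRW d Ω) (x : Zd d) : ∀ᵐ p ∂(nu W x), p 0 = x := by
  have := W.isProb x
  have h := W.Y_zero x
  have hm : MeasurableSet {ω | W.Y 0 ω = x} := W.measurable_Y 0 (measurableSet_singleton x)
  have h2 : ∀ᵐ ω ∂(W.P x), W.Y 0 ω = x := (prob_compl_eq_zero_iff hm).2 h
  unfold nu
  rw [ae_map_iff (pth_meas W).aemeasurable]
  · exact h2
  · exact (measurable_pi_apply (X := fun _ : ℕ => Zd d) 0) (measurableSet_singleton x)

lemma cyl_meas (n : ℕ) (s : ℕ → Zd d) : MeasurableSet {p : ℕ → Zd d | ∀ k ≤ n, p k = s k} := by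
  have : {p : ℕ → Zd d | ∀ k ≤ n, p k = s k} = ⋂ k, ⋂ (_ : k ≤ n), {p | p k = s k} := by ext; simp
  rw [this]
  exact MeasurableSet.iInter fun k => MeasurableSet.iInter fun _ =>
    (measurable_pi_apply (X := fun _ : ℕ => Zd d) k) (measurableSet_singleton (s k))

lemma nu_cyl (W : SRW d Ω) (x : Zd d) (n : ℕ) (s : ℕ → Zd d) :
    nu W x {p | ∀ k ≤ n, p k = s k} =
      (if s 0 = x then 1 else 0) * ∏ i : Fin n, stepP d (s (i + 1) - s i) := by
  split_ifs with h
  · rw [one_mul]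
    have hl := W.law x n (fun i => s (i + 1) - s i) (fun _ => univ) (fun _ => MeasurableSet.univ)
    simp only [measure_univ, Finset.prod_const_one, mul_one] at hl
    rw [← hl]
    have h3 : nu W x {p | ∀ k ≤ n, p k = s k} =
        nu W x {p | ∀ i : Fin n, p (i + 1) - p i = s (i + 1) - s i} := by
      refine measure_congr ?_
      filter_upwards [nu_zero W x] with p hp
      refine propext ⟨fun hk i => ?_, fun hk k => ?_⟩
      · have hk : ∀ k ≤ n, p k = s k := hk
        show p (i + 1) - p i = s (i + 1) - s i
        rw [hk _ (by omega), hk _ (by omega)]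
      · have hk : ∀ i : Fin n, p (i + 1) - p i = s (i + 1) - s i := hk
        show k ≤ n → p k = s k
        induction k with
        | zero => intro _; rw [hp, h]
        | succ k ih =>
          intro hkn
          have h1 := hk ⟨k, by omega⟩
          have h2 := ih (by omega)
          simp only at h1
          rw [h2] at h1
          exact sub_left_injective h1
    rw [h3]
    unfold nu
    rw [Measure.map_apply (pth_meas W)]
    · congr 1
      ext ω
      simp [pth]
    · have : {p : ℕ → Zd d | ∀ i : Fin n, p (i + 1) - p i = s (i + 1) - s i} =
        ⋂ i : Fin n, {p | p (i + 1) - p i = s (i + 1) - s i} := by ext; simp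
      rw [this]
      refine MeasurableSet.iInter fun i => ?_
      exact ((measurable_pi_apply ((i:ℕ) + 1)).sub (measurable_pi_apply (i:ℕ))) (measurableSet_singleton _)
  · rw [zero_mul]
    refine measure_mono_null (t := {p | ¬ p 0 = x}) ?_ (nu_zero W x)
    intro p hp hx
    exact h (by rw [← hp 0 (by omega), hx])

lemma nu_shift (W : SRW d Ω) (x : Zd d) :
    (nu W x).map shf = ∑ j : Fin d × Bool, ((2 * d : ℕ) : ℝ≥0∞)⁻¹ • nu W (x + e j) := by
  by_cases hd : d = 0
  · exfalso
    subst hd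
    have := nu_cyl W x 1 (fun _ => x)
    have h1 : nu W x {p | ∀ k ≤ 1, p k = x} = 1 := by
      have : {p : ℕ → Zd 0 | ∀ k ≤ 1, p k = x} = univ := by
        ext p; simp only [mem_ofPred_eq, mem_univ, iff_true]; intro k _; exact Subsingleton.elim _ _
      rw [this]; exact measure_univ
    simp only at this
    rw [h1] at this
    simp [stepP] at this
  have hfin : ((2 * d : ℕ) : ℝ≥0∞)⁻¹ ≠ ⊤ := by
    rw [Ne, ENNReal.inv_eq_top]; exact_mod_cast (by omega : 2 * d ≠ 0)
  have : IsFiniteMeasure (∑ j : Fin d × Bool, ((2 * d : ℕ) : ℝ≥0∞)⁻¹ • nu W (x + e j)) := by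
    refine ⟨?_⟩
    rw [Measure.finsetSum_apply]
    refine ENNReal.sum_lt_top.2 fun j _ => ?_
    rw [Measure.smul_apply]
    simpa using hfin.lt_top
  refine ext_path _ _ fun n s => ?_
  rw [Measure.map_apply shf_meas (cyl_meas n s), Measure.finsetSum_apply]
  have h1 : nu W x (shf ⁻¹' {p | ∀ k ≤ n, p k = s k}) =
    nu W x {p | ∀ k ≤ n + 1, p k = (fun k => Nat.casesOn k x s : ℕ → Zd d) k} := by
    refine measure_congr ?_
    filter_upwards [nu_zero W x] with p hp
    refine propext ⟨fun hk => ?_, fun hk => ?_⟩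
    · have hk : ∀ k ≤ n, p (k+1) = s k := hk
      show ∀ k ≤ n + 1, p k = (fun k => Nat.casesOn k x s : ℕ → Zd d) k
      rintro (_ | k) h
      · exact hp
      · exact hk k (by omega)
    · have hk : ∀ k ≤ n + 1, p k = (fun k => Nat.casesOn k x s : ℕ → Zd d) k := hk
      show ∀ k ≤ n, p (k+1) = s k
      intro k h
      exact hk (k+1) (by omega)
  rw [h1, nu_cyl, if_pos (show (fun k => Nat.casesOn k x s : ℕ → Zd d) 0 = x from rfl), one_mul, Fin.prod_univ_succ]
  simp only [Fin.val_zero, Fin.val_succ, Measure.smul_apply, smul_eq_mul]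
  rw [stepP_eq, Finset.sum_mul]
  refine Finset.sum_congr rfl fun j _ => ?_
  rw [nu_cyl, mul_assoc]
  congr 3
  rw [sub_eq_iff_eq_add, add_comm]
  rfl

/-- real-valued law -/
noncomputable def pr (W : SRW d Ω) (G : Set (ℕ → Zd d)) (x : Zd d) : ℝ := (nu W x G).toReal

lemma pr_shift (hd : 1 ≤ d) (W : SRW d Ω) (x : Zd d) {G : Set (ℕ → Zd d)} (hG : MeasurableSet G) :
    sm (pr W G) x = 2 * d * pr W (shf ⁻¹' G) x := by
  unfold pr
  rw [← Measure.map_apply shf_meas hG, nu_shift, Measure.finsetSum_apply, ENNReal.toReal_sum]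
  · simp only [Measure.smul_apply, smul_eq_mul, ENNReal.toReal_mul, ENNReal.toReal_inv]
    rw [← Finset.mul_sum, ← mul_assoc]
    have : (2 * (d:ℝ)) * (((2 * d : ℕ) : ℝ≥0∞).toReal)⁻¹ = 1 := by
      rw [ENNReal.toReal_natCast]; push_cast; field_simp
    rw [this, one_mul]
    rfl
  · intro j _
    rw [Measure.smul_apply, smul_eq_mul]
    refine ENNReal.mul_ne_top ?_ (measure_ne_top _ _)
    rw [Ne, ENNReal.inv_eq_top]; exact_mod_cast (by omega : 2 * d ≠ 0)

lemma pr_congr (W : SRW d Ω) (x : Zd d) {G G' : Set (ℕ → Zd d)}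
    (h : ∀ p : ℕ → Zd d, p 0 = x → (p ∈ G ↔ p ∈ G')) : pr W G x = pr W G' x := by
  unfold pr
  congr 1
  refine measure_congr ?_
  filter_upwards [nu_zero W x] with p hp
  exact propext (h p hp)

lemma pr_mono (W : SRW d Ω) (x : Zd d) {G G' : Set (ℕ → Zd d)}
    (h : ∀ p : ℕ → Zd d, p 0 = x → (p ∈ G → p ∈ G')) : pr W G x ≤ pr W G' x := by
  unfold pr
  refine ENNReal.toReal_mono (measure_ne_top _ _) (measure_mono_ae ?_)
  filter_upwards [nu_zero W x] with p hp
  exact h p hp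

lemma pr_nonneg (W : SRW d Ω) (x : Zd d) (G : Set (ℕ → Zd d)) : 0 ≤ pr W G x := ENNReal.toReal_nonneg

lemma pr_le_one (W : SRW d Ω) (x : Zd d) (G : Set (ℕ → Zd d)) : pr W G x ≤ 1 := by
  unfold pr
  exact ENNReal.toReal_le_of_le_ofReal zero_le_one (by simpa using prob_le_one)

lemma pr_empty (W : SRW d Ω) (x : Zd d) : pr W ∅ x = 0 := by simp [pr]
lemma pr_univ (W : SRW d Ω) (x : Zd d) : pr W univ x = 1 := by simp [pr]

lemma pr_diff (W : SRW d Ω) (x : Zd d) {G G' : Set (ℕ → Zd d)} (h : G' ⊆ G) (hG : MeasurableSet G') :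
    pr W (G \ G') x = pr W G x - pr W G' x := by
  unfold pr
  exact measureReal_sdiff h hG

lemma NA_meas (A : Set (Zd d)) : MeasurableSet (NA A) := by
  have : NA A = ⋂ k, {p | p k ∈ Aᶜ} := by ext; simp [NA]
  rw [this]
  exact MeasurableSet.iInter fun k => measurable_pi_apply k (Set.to_countable _).measurableSet

lemma co_meas (k : ℕ) (A : Set (Zd d)) : MeasurableSet {p : ℕ → Zd d | p k ∈ A} :=
  measurable_pi_apply k (Set.to_countable _).measurableSet

lemma GE_meas (A B U : Set (Zd d)) : MeasurableSet (GE A B U) := by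
  have : GE A B U = ⋃ m, ({p | p m ∈ Uᶜ} ∩ (⋂ k, ⋂ (_ : k < m), {p | p k ∈ U}) ∩
    (⋃ k, ⋃ (_ : m ≤ k), {p | p k ∈ B \ A}) ∩ (⋂ k, ⋂ (_ : m ≤ k), {p | p k ∈ Aᶜ})) := by
    ext p
    simp only [GE, mem_ofPred_eq, mem_iUnion, mem_inter_iff, mem_iInter, mem_compl_iff, exists_prop, and_assoc]
  rw [this]
  refine MeasurableSet.iUnion fun m => (((co_meas _ _).inter ?_).inter ?_).inter ?_
  · exact MeasurableSet.iInter fun k => MeasurableSet.iInter fun _ => co_meas _ _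
  · exact MeasurableSet.iUnion fun k => MeasurableSet.iUnion fun _ => co_meas _ _
  · exact MeasurableSet.iInter fun k => MeasurableSet.iInter fun _ => co_meas _ _

end S5

namespace S5

variable {d : ℕ} {Ω : Type*} [MeasurableSpace Ω]

/-- hitting within `n` steps -/
def HB (n : ℕ) (A : Set (Zd d)) : Set (ℕ → Zd d) := {p | ∃ k ≤ n, p k ∈ A}

lemma HB_meas (n : ℕ) (A : Set (Zd d)) : MeasurableSet (HB n A) := by
  have : HB n A = ⋃ k, ⋃ (_ : k ≤ n), {p | p k ∈ A} := by ext; simp [HB]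
  rw [this]
  exact MeasurableSet.iUnion fun k => MeasurableSet.iUnion fun _ => co_meas _ _

lemma hb_bound (hd : 3 ≤ d) (W : SRW d Ω) (A : Set (Zd d)) (m : ℝ) (hm : 0 ≤ m)
    (hA : ∀ y ∈ A, m ≤ w y) (n : ℕ) : ∀ x, m * pr W (HB n A) x ≤ w x := by
  have hd0 : (0:ℝ) < d := by exact_mod_cast (by omega : 0 < d)
  have hin : ∀ n, ∀ x ∈ A, m * pr W (HB n A) x ≤ w x := fun n x hx =>
    (mul_le_of_le_one_right hm (pr_le_one W x _)).trans (hA x hx)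
  induction n with
  | zero =>
    intro x
    by_cases hx : x ∈ A
    · exact hin _ x hx
    · rw [pr_congr W x (G' := ∅), pr_empty, mul_zero]
      · exact (w_pos x).le
      · intro p hp
        simp [HB, hp, hx]
  | succ n ih =>
    intro x
    by_cases hx : x ∈ A
    · exact hin _ x hx
    · rw [pr_congr W x (G' := shf ⁻¹' HB n A)]
      · have h1 := pr_shift (by omega) W x (HB_meas n A)
        have h2 : m * sm (pr W (HB n A)) x ≤ sm w x := by
          unfold sm
          rw [Finset.mul_sum]
          exact Finset.sum_le_sum fun j _ => ih _
        have h3 := w_super hd x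
        rw [h1] at h2
        have : 2 * (d:ℝ) * (m * pr W (shf ⁻¹' HB n A) x) ≤ 2 * d * w x := by linarith
        exact le_of_mul_le_mul_left this (by positivity)
      · intro p hp
        constructor
        · rintro ⟨k, hk, hkA⟩
          cases k with
          | zero => exact absurd (hp ▸ hkA) hx
          | succ k => exact ⟨k, by omega, hkA⟩
        · rintro ⟨k, hk, hkA⟩
          exact ⟨k + 1, by omega, hkA⟩

lemma hit_bound (hd : 3 ≤ d) (W : SRW d Ω) (A : Set (Zd d)) (m : ℝ) (hm : 0 ≤ m)
    (hA : ∀ y ∈ A, m ≤ w y) (x : Zd d) : m * (1 - pr W (NA A) x) ≤ w x := by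
  have h1 : 1 - pr W (NA A) x = pr W (⋃ n, HB n A) x := by
    rw [← pr_univ W x, ← pr_diff W x (subset_univ _) (NA_meas A)]
    refine pr_congr W x fun p _ => ?_
    simp only [NA, HB, mem_sdiff, mem_univ, true_and, mem_iUnion, mem_ofPred_eq, not_forall, not_not]
    exact ⟨fun ⟨k, hk⟩ => ⟨k, k, le_rfl, hk⟩, fun ⟨_, k, _, hk⟩ => ⟨k, hk⟩⟩
  rw [h1]
  have h2 : Filter.Tendsto (fun n => m * pr W (HB n A) x) Filter.atTop
      (nhds (m * pr W (⋃ n, HB n A) x)) := by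
    refine Filter.Tendsto.const_mul _ ?_
    unfold pr
    refine (ENNReal.tendsto_toReal (measure_ne_top _ _)).comp (tendsto_measure_iUnion_atTop ?_)
    intro n n' hn p ⟨k, hk, hkA⟩
    exact ⟨k, hk.trans hn, hkA⟩
  exact le_of_tendsto' h2 fun n => hb_bound hd W A m hm hA n x

lemma hit_ratio (hd : 3 ≤ d) (W : SRW d Ω) (A : Set (Zd d)) {L n : ℕ} (hL : 1 ≤ L) (hn : 1 ≤ n)
    (hA : A ⊆ ball (0 : Zd d) L) (hne : A.Nonempty) {x : Zd d} (hx : x ∉ ball (0 : Zd d) (n * L)) :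
    1 - pr W (NA A) x ≤ ((d : ℝ) + 48) / n := by
  obtain ⟨y, hy, hmin⟩ := ((ball_finite L).subset hA).exists_minimalFor w A hne
  have hmin' : ∀ z ∈ A, w y ≤ w z := fun z hz => by
    rcases le_total (w y) (w z) with h | h
    · exact h
    · exact hmin hz h
  have h1 := hit_bound hd W A (w y) (w_pos y).le hmin' x
  have h2 := w_ratio hL hn hx (hA hy)
  have h3 := w_pos y
  have : w y * (1 - pr W (NA A) x) ≤ w y * (((d : ℝ) + 48) / n) := by linarith
  exact le_of_mul_le_mul_left this h3

lemma NA_harm (hd : 3 ≤ d) (W : SRW d Ω) (A : Set (Zd d)) {x : Zd d} (hx : x ∉ A) :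
    sm (pr W (NA A)) x = 2 * d * pr W (NA A) x := by
  rw [pr_shift (by omega) W x (NA_meas A)]
  congr 1
  refine pr_congr W x fun p hp => ?_
  constructor
  · intro h k
    cases k with
    | zero => rw [hp]; exact hx
    | succ k => exact h k
  · intro h k
    exact h (k + 1)

lemma NA_zero (W : SRW d Ω) (A : Set (Zd d)) {x : Zd d} (hx : x ∈ A) : pr W (NA A) x = 0 := by
  rw [pr_congr W x (G' := ∅), pr_empty]
  intro p hp
  simp only [NA, mem_ofPred_eq, mem_empty_iff_false, iff_false, not_forall, not_not]
  exact ⟨0, hp ▸ hx⟩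

lemma GE_harm (hd : 3 ≤ d) (W : SRW d Ω) (A B U : Set (Zd d)) {x : Zd d} (hx : x ∈ U) :
    sm (pr W (GE A B U)) x = 2 * d * pr W (GE A B U) x := by
  rw [pr_shift (by omega) W x (GE_meas A B U)]
  congr 1
  refine pr_congr W x fun p hp => ?_
  constructor
  · rintro ⟨m, h1, h2, ⟨k, hk, hkB⟩, h4⟩
    refine ⟨m + 1, h1, ?_, ⟨k + 1, by omega, hkB⟩, ?_⟩
    · intro i hi
      cases i with
      | zero => rw [hp]; exact hx
      | succ i => exact h2 i (by omega)
    · intro i hi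
      cases i with
      | zero => omega
      | succ i => exact h4 i (by omega)
  · rintro ⟨m, h1, h2, ⟨k, hk, hkB⟩, h4⟩
    cases m with
    | zero => exact absurd (hp ▸ hx) h1
    | succ m =>
      cases k with
      | zero => omega
      | succ k =>
        exact ⟨m, h1, fun i hi => h2 (i+1) (by omega), ⟨k, by omega, hkB⟩,
          fun i hi => h4 (i+1) (by omega)⟩

lemma GE_out (W : SRW d Ω) {A B : Set (Zd d)} (U : Set (Zd d)) (hAB : A ⊆ B) {x : Zd d} (hx : x ∉ U) :
    pr W (NA A) x - pr W (NA B) x = pr W (GE A B U) x := by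
  have hs : NA B ⊆ NA A := fun p hp k hk => hp k (hAB hk)
  rw [← pr_diff W x hs (NA_meas B)]
  refine pr_congr W x fun p hp => ?_
  constructor
  · rintro ⟨h1, h2⟩
    simp only [NA, mem_ofPred_eq, not_forall, not_not] at h2
    obtain ⟨k, hk⟩ := h2
    exact ⟨0, by rw [hp]; exact hx, fun k hk => absurd hk (by omega),
      ⟨k, by omega, hk, h1 k⟩, fun k _ => h1 k⟩
  · rintro ⟨m, h1, h2, ⟨k, hk, hkB⟩, h4⟩
    cases m with
    | zero => exact ⟨fun k => h4 k (by omega), fun h => h k hkB.1⟩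
    | succ m => exact absurd (h2 0 (by omega)) (by rw [hp]; exact hx)

lemma eqm_eq (hd : 3 ≤ d) (W : SRW d Ω) {A : Set (Zd d)} {y : Zd d} (hy : y ∈ A) :
    2 * d * W.eqm A y = sm (pr W (NA A)) y := by
  rw [pr_shift (by omega) W y (NA_meas A)]
  congr 1
  unfold SRW.eqm pr nu
  rw [if_pos hy, Measure.map_apply (pth_meas W) (shf_meas (NA_meas A))]
  congr 1
  refine measure_congr ?_
  filter_upwards [ae_good W y] with ω hg
  exact propext (hitTilde_top hg A)

lemma q_eq (W : SRW d Ω) (A B U : Set (Zd d)) (x : Zd d) :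
    (W.P x {ω | W.hitFrom (B \ A) (W.exit U ω) ω < ⊤ ∧ W.hitFrom A (W.exit U ω) ω = ⊤}).toReal
      = pr W (GE A B U) x := by
  unfold pr nu
  rw [Measure.map_apply (pth_meas W) (GE_meas A B U)]
  congr 1
  refine measure_congr ?_
  filter_upwards [ae_good W x] with ω hg
  exact propext (event_iff hg A B U)

end S5


/-- Proposition 1.4: for `K ≥ c₁`, `A ⊆ B(0,L)`, finite `B` with
`B ∩ B(0,KL) = A`, and `y ∈ A`, one has `0 ≤ e_A(y) − e_B(y)` and
`(1 − c₂/K)·e_A(y)·q ≤ e_A(y) − e_B(y) ≤ (1 + c₂/K)·e_A(y)·q`, where `q` is the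
probability that the walk started at `0`, after its exit time from `U = B(0,KL)`,
visits `B∖A` but never visits `A`. -/
theorem statement5 {d : ℕ} (hd : 3 ≤ d) {Ω : Type*} [MeasurableSpace Ω] (W : SRW d Ω) :
    ∃ c₁ c₂ : ℝ, 2 ≤ c₁ ∧ 0 < c₂ ∧
      ∀ (L K : ℕ), 1 ≤ L → c₁ ≤ (K : ℝ) →
        ∀ A : Set (Zd d), A ⊆ ball (0 : Zd d) L →
          ∀ B : Set (Zd d), B.Finite → B ∩ ball (0 : Zd d) (K * L) = A →
            ∀ y ∈ A,
              0 ≤ W.eqm A y - W.eqm B y ∧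
              (1 - c₂ / K) * (W.eqm A y *
                  (W.P 0 {ω |
                    W.hitFrom (B \ A) (W.exit (ball (0 : Zd d) (K * L)) ω) ω < ⊤ ∧
                    W.hitFrom A (W.exit (ball (0 : Zd d) (K * L)) ω) ω = ⊤}).toReal)
                ≤ W.eqm A y - W.eqm B y ∧
              W.eqm A y - W.eqm B y ≤ (1 + c₂ / K) * (W.eqm A y *
                  (W.P 0 {ω |
                    W.hitFrom (B \ A) (W.exit (ball (0 : Zd d) (K * L)) ω) ω < ⊤ ∧
                    W.hitFrom A (W.exit (ball (0 : Zd d) (K * L)) ω) ω = ⊤}).toReal) := by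
  have hd' : (3 : ℝ) ≤ d := by exact_mod_cast hd
  have hd9 : (1 : ℝ) ≤ (d : ℝ) ^ 9 := one_le_pow₀ (by linarith)
  set M : ℕ := 2 * (d + 48) with hMdef
  have hM : (M : ℝ) = 2 * ((d : ℝ) + 48) := by rw [hMdef]; push_cast; ring
  have hM0 : (102 : ℝ) ≤ M := by rw [hM]; linarith
  have hdM : (M : ℝ) ≤ (d : ℝ) ^ 9 * M := by nlinarith
  refine ⟨23040 * (d : ℝ) ^ 9 * M, 4 * (46080 * (d : ℝ) ^ 9 * M), by nlinarith, by positivity, ?_⟩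
  intro L K hL hK A hA B _ hBA y hy
  have hK1 : (102 : ℝ) ≤ K := by nlinarith
  have hKn : 1 ≤ K := by
    have : (1 : ℝ) ≤ K := by linarith
    exact_mod_cast this
  have hAB : A ⊆ B := by rw [← hBA]; exact Set.inter_subset_left
  have hyB := hAB hy
  rw [S5.q_eq]
  set U := ball (0 : Zd d) (K * L) with hU
  have hsm : ∀ z, S5.sm (fun x => S5.pr W (S5.NA A) x - S5.pr W (S5.NA B) x) z =
      S5.sm (S5.pr W (S5.NA A)) z - S5.sm (S5.pr W (S5.NA B)) z := by
    intro z
    simp only [S5.sm, Finset.sum_sub_distrib]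
  have hmono : ∀ x, S5.pr W (S5.NA B) x ≤ S5.pr W (S5.NA A) x := fun x =>
    S5.pr_mono W x fun p _ hp k hk => hp k (hAB hk)
  have hc := S5.core (d := d) (by omega) hL (M := M) (K := K) (by omega) hA hU hK
    (ε := 46080 * (d : ℝ) ^ 9 * M / K) le_rfl
    (h := S5.pr W (S5.GE A B U)) (f := fun x => S5.pr W (S5.NA A) x - S5.pr W (S5.NA B) x)
    (p := S5.pr W (S5.NA A))
    (fun x => S5.pr_nonneg W x _)
    (fun x hx => S5.GE_harm hd W A B U hx)
    (fun x hx hxA => by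
      have hxB : x ∉ B := fun h => hxA (by rw [← hBA]; exact ⟨h, hx⟩)
      rw [hsm, S5.NA_harm hd W A hxA, S5.NA_harm hd W B hxB]; ring)
    (fun x hx => S5.NA_harm hd W A hx)
    (fun x hx => by
      simp only [S5.NA_zero W A hx, S5.NA_zero W B (hAB hx), sub_zero])
    (fun x hx => S5.NA_zero W A hx)
    (fun x hx => S5.GE_out W U hAB hx)
    (fun x => S5.pr_le_one W x _)
    (fun x hx => by
      refine (S5.hit_ratio hd W A hL hKn hA ⟨y, hy⟩ hx).trans ?_
      gcongr
      nlinarith)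
    (fun x hx => by
      have h1 := S5.hit_ratio hd W A hL (n := M) (by omega) hA ⟨y, hy⟩ hx
      have h2 : ((d : ℝ) + 48) / M = 1 / 2 := by rw [hM]; field_simp
      linarith)
    hy
  have h0 : 0 ≤ S5.sm (fun x => S5.pr W (S5.NA A) x - S5.pr W (S5.NA B) x) y :=
    Finset.sum_nonneg fun j _ => sub_nonneg.2 (hmono _)
  rw [hsm, ← S5.eqm_eq hd W hy, ← S5.eqm_eq hd W hyB] at hc h0
  obtain ⟨hc1, hc2⟩ := hc
  have hpos : (0 : ℝ) < 2 * d := by linarith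
  have hcc : 4 * (46080 * (d : ℝ) ^ 9 * M) / K = 4 * (46080 * (d : ℝ) ^ 9 * M / K) := by ring
  rw [hcc]
  generalize 46080 * (d : ℝ) ^ 9 * M / K = ε at *
  refine ⟨?_, ?_, ?_⟩
  · refine le_of_mul_le_mul_left ?_ hpos
    linarith
  · refine le_of_mul_le_mul_left ?_ hpos
    linarith
  · refine le_of_mul_le_mul_left ?_ hpos
    linarith
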